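/- arXiv:1806.08988 — 8 statements merged into one kernel-verified Lean document; each statement's English description precedes it below -/
import Mathlib

section
/- Let F : [r,T] × C([0,T],ℝ^m) → ℝ^m be product measurable and non-anticipative, and assume conditions (C.1) and (C.2) hold. Then for every x̂ ∈ C([0,T],ℝ^m) the path-dependent ODE ẋ(t) = F(t,x) for t ∈ [r,T] admits a unique mild solution x satisfying x(s) = x̂(s) for all s ∈ [0,r]; moreover this solution x belongs to H¹_r([0,T],ℝ^m). -/
open MeasureTheory Set Filter

noncomputable section

variable {E F' : Type*} [NormedAddCommGroup E] [NormedSpace ℝ E] [CompleteSpace E]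
  [NormedAddCommGroup F']

/-- Supremum of `‖x‖` over the interval `[a, b]`. -/
def supIcc (a b : ℝ) (x : ℝ → E) : ℝ :=
  sSup ((fun u => ‖x u‖) '' Set.Icc a b)

/-- `x` is absolutely continuous on `[r, T]` with integrable derivative `x'`,
in the sense of the fundamental theorem of calculus. -/
def IsACDeriv (r T : ℝ) (x x' : ℝ → E) : Prop :=
  IntegrableOn x' (Set.Icc r T) ∧
    ∀ t ∈ Set.Icc r T, x t = x r + ∫ s in Set.Icc r t, x' s

/-- Delayed Cameron–Martin norm of a path `x` with derivative `x'`: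
`‖x‖_{H,r} = ‖x^r‖_∞ + (∫_r^T |ẋ(s)|² ds)^{1/2}`. -/
def hNorm (r T : ℝ) (x x' : ℝ → E) : ℝ :=
  supIcc 0 T (fun s => x (min s r)) + Real.sqrt (∫ s in Set.Icc r T, ‖x' s‖ ^ 2)

/-- Membership in the delayed Cameron–Martin space `H¹_r([0,T])`, with derivative `x'`. -/
def MemH1 (r T : ℝ) (x x' : ℝ → E) : Prop :=
  ContinuousOn x (Set.Icc 0 T) ∧ IsACDeriv r T x x' ∧
    IntegrableOn (fun s => ‖x' s‖ ^ 2) (Set.Icc r T)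

/-- A functional on `[r,T] × C([0,T])` is non-anticipative if its value at time `t`
only depends on the path up to time `t`. -/
def NonAnticipative (r T : ℝ) (G : ℝ → (ℝ → E) → F') : Prop :=
  ∀ t ∈ Set.Icc r T, ∀ x y : ℝ → E, (∀ s ∈ Set.Icc 0 t, x s = y s) → G t x = G t y

/-- Product measurability of a functional on `[r,T] × C([0,T])`. -/
def ProdMeasurable [MeasurableSpace E] [MeasurableSpace F'] (G : ℝ → (ℝ → E) → F') : Prop :=
  Measurable fun p : ℝ × (ℝ → E) => G p.1 p.2

/-- Mild solution of the path-dependent ODE `ẋ(t) = G(t, x)` on `[r,T]`. -/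
def IsMildSol (r T : ℝ) (G : ℝ → (ℝ → E) → E) (x : ℝ → E) : Prop :=
  ContinuousOn x (Set.Icc 0 T) ∧ IntegrableOn (fun s => G s x) (Set.Icc r T) ∧
    ∀ t ∈ Set.Icc r T, x t = x r + ∫ s in Set.Icc r t, G s x

/-- Condition (C.1): affine growth in terms of the initial segment and the total
variation of the derivative. -/
def CondC1 (r T : ℝ) (G : ℝ → (ℝ → E) → E) : Prop :=
  ∃ c₀ : ℝ → ℝ, Measurable c₀ ∧ (∀ s, 0 ≤ c₀ s) ∧
    IntegrableOn (fun s => c₀ s ^ 2) (Set.Icc r T) ∧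
    ∀ t ∈ Set.Icc r T, ∀ x x' : ℝ → E, ContinuousOn x (Set.Icc 0 T) → IsACDeriv r T x x' →
      ‖G t x‖ ≤ c₀ t * (1 + supIcc 0 T (fun s => x (min s r)) + ∫ s in Set.Icc r T, ‖x' s‖)

/-- Condition (C.2): Lipschitz continuity on bounded subsets of `H¹_r` in the
delayed Cameron–Martin norm. -/
def CondC2 (r T : ℝ) (G : ℝ → (ℝ → E) → E) : Prop :=
  ∀ n : ℕ, ∃ lam : ℝ → ℝ, Measurable lam ∧ (∀ s, 0 ≤ lam s) ∧
    IntegrableOn (fun s => lam s ^ 2) (Set.Icc r T) ∧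
    ∀ t ∈ Set.Icc r T, ∀ x x' y y' : ℝ → E, MemH1 r T x x' → MemH1 r T y y' →
      hNorm r T x x' ≤ (n : ℝ) → hNorm r T y y' ≤ (n : ℝ) →
      ‖G t x - G t y‖ ≤ lam t * hNorm r T (fun s => x s - y s) (fun s => x' s - y' s)

end

open scoped Topology

set_option linter.unusedSectionVars false

namespace PathODE

lemma setIntegral_Icc_mono {r t t' : ℝ} {f : ℝ → ℝ} (htt : t ≤ t')
    (hf : IntegrableOn f (Icc r t')) (h0 : ∀ s ∈ Icc r t', 0 ≤ f s) :
    ∫ s in Icc r t, f s ≤ ∫ s in Icc r t', f s := by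
  refine setIntegral_mono_set hf ?_ (LE.le.eventuallyLE (Icc_subset_Icc_right htt))
  exact (ae_restrict_iff' measurableSet_Icc).2 (Eventually.of_forall h0)

lemma expWeight_integrable {r T : ℝ} {k : ℝ → ℝ} (β : ℝ)
    (hk : IntegrableOn k (Icc r T)) :
    IntegrableOn (fun s => k s * Real.exp (β * ∫ u in Icc r s, k u)) (Icc r T) := by
  have hc : ContinuousOn (fun s => Real.exp (β * ∫ u in Icc r s, k u)) (Icc r T) :=
    Real.continuous_exp.comp_continuousOn
      (continuousOn_const.mul (intervalIntegral.continuousOn_primitive_Icc hk))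
  exact hk.mul_continuousOn hc isCompact_Icc

lemma expWeight_le {r T : ℝ} {k : ℝ → ℝ} {β : ℝ} (hβ : 0 < β)
    (hk : IntegrableOn k (Icc r T)) (hk0 : ∀ s, 0 ≤ k s) {t : ℝ} (ht : t ∈ Icc r T) :
    ∫ s in Icc r t, k s * Real.exp (β * ∫ u in Icc r s, k u) ≤
      (Real.exp (β * ∫ u in Icc r t, k u) - 1) / β := by
  have hkt : IntegrableOn k (Icc r t) := hk.mono_set (Icc_subset_Icc_right ht.2)
  have hK : ∀ s ∈ Icc r t, ∫ u in Icc r s, k u = ∫ u in r..s, k u := fun s hs => by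
    rw [intervalIntegral.integral_of_le hs.1, integral_Icc_eq_integral_Ioc]
  have hint : IntervalIntegrable k volume r t := by
    rw [intervalIntegrable_iff_integrableOn_Icc_of_le ht.1]; exact hkt
  let f : ℝ → ℝ := fun s => Real.exp (β * ∫ u in r..s, k u)
  have hmono : MonotoneOn f (uIcc r t) := by
    rw [uIcc_of_le ht.1]
    intro a ha b hb hab
    refine Real.exp_le_exp.2 (mul_le_mul_of_nonneg_left ?_ hβ.le)
    rw [← hK a ha, ← hK b hb]
    exact setIntegral_Icc_mono hab (hkt.mono_set (Icc_subset_Icc_right hb.2)) (fun s _ => hk0 s)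
  have h1 := hmono.intervalIntegral_deriv_mem_uIcc
  have hle : f r ≤ f t := hmono (by simp) (by simp) ht.1
  rw [uIcc_of_le (by linarith)] at h1
  have h2 := h1.2
  have hfr : f r = 1 := by simp [f]
  have heq : ∫ s in r..t, deriv f s = ∫ s in r..t, β * (k s * f s) := by
    refine intervalIntegral.integral_congr_ae ?_
    filter_upwards [hint.ae_hasDerivAt_integral] with s hs hs'
    have := hs (uIoc_subset_uIcc hs') r left_mem_uIcc
    have h3 := ((this.const_mul β).exp).deriv
    simp only [f]
    rw [h3]; ring
  rw [heq, intervalIntegral.integral_const_mul, hfr] at h2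
  have h4 : ∫ s in Icc r t, k s * Real.exp (β * ∫ u in Icc r s, k u) = ∫ s in r..t, k s * f s := by
    rw [intervalIntegral.integral_of_le ht.1, ← integral_Icc_eq_integral_Ioc]
    refine setIntegral_congr_fun measurableSet_Icc fun s hs => ?_
    simp only [f, hK s hs]
  rw [h4, hK t ⟨ht.1, le_rfl⟩, le_div_iff₀ hβ, mul_comm]
  exact h2

/-- iterated Volterra inequality -/
lemma volterra_iter {r T : ℝ} {k : ℝ → ℝ} (hk : IntegrableOn k (Icc r T)) (hk0 : ∀ s, 0 ≤ k s)
    (d : ℕ → ℝ → ℝ) (hd : ∀ n, IntegrableOn (d n) (Icc r T)) (hd0 : ∀ n s, 0 ≤ d n s)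
    (hstep : ∀ n, ∀ t ∈ Icc r T, d (n + 1) t ≤ k t * ∫ s in Icc r t, d n s) (n : ℕ) :
    ∀ t ∈ Icc r T, ∫ s in Icc r t, d n s ≤
      (∫ s in Icc r T, d 0 s) * (1 / 4) ^ n * Real.exp (4 * ∫ u in Icc r t, k u) := by
  have hA : 0 ≤ ∫ s in Icc r T, d 0 s := integral_nonneg (hd0 0)
  induction n with
  | zero =>
    intro t ht
    have h1 : ∫ s in Icc r t, d 0 s ≤ ∫ s in Icc r T, d 0 s :=
      setIntegral_Icc_mono ht.2 (hd 0) (fun s _ => hd0 0 s)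
    have h2 : 1 ≤ Real.exp (4 * ∫ u in Icc r t, k u) :=
      Real.one_le_exp (mul_nonneg (by norm_num) (integral_nonneg hk0))
    simp only [pow_zero, mul_one]
    nlinarith
  | succ n ih =>
    intro t ht
    set A := ∫ s in Icc r T, d 0 s
    have hsub : Icc r t ⊆ Icc r T := Icc_subset_Icc_right ht.2
    have h1 : ∫ s in Icc r t, d (n + 1) s ≤
        ∫ s in Icc r t, (A * (1 / 4) ^ n) * (k s * Real.exp (4 * ∫ u in Icc r s, k u)) := by
      refine setIntegral_mono_on ((hd (n + 1)).mono_set hsub)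
        (((expWeight_integrable 4 hk).mono_set hsub).const_mul _) measurableSet_Icc ?_
      intro s hs
      refine (hstep n s (hsub hs)).trans ?_
      calc k s * ∫ u in Icc r s, d n u ≤ k s * (A * (1 / 4) ^ n *
            Real.exp (4 * ∫ u in Icc r s, k u)) :=
            mul_le_mul_of_nonneg_left (ih s (hsub hs)) (hk0 s)
        _ = _ := by ring
    rw [integral_const_mul] at h1
    have h2 := expWeight_le (β := 4) (by norm_num) hk hk0 ht
    have h3 : 0 ≤ A * (1 / 4) ^ n := by positivity
    calc _ ≤ _ := h1
      _ ≤ A * (1 / 4) ^ n * ((Real.exp (4 * ∫ u in Icc r t, k u) - 1) / 4) :=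
          mul_le_mul_of_nonneg_left h2 h3
      _ ≤ A * (1 / 4) ^ n * ((Real.exp (4 * ∫ u in Icc r t, k u)) / 4) :=
          mul_le_mul_of_nonneg_left (by linarith) h3
      _ = _ := by ring

variable {E : Type*} [NormedAddCommGroup E] [NormedSpace ℝ E] [CompleteSpace E]

/-- path with initial segment `xhat` and derivative `φ` -/
noncomputable def path (r : ℝ) (xhat φ : ℝ → E) : ℝ → E :=
  fun s => xhat (min s r) + ∫ u in Icc r s, φ u

lemma integral_Icc_of_le {r s : ℝ} (φ : ℝ → E) (h : s ≤ r) : ∫ u in Icc r s, φ u = 0 := by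
  rw [integral_Icc_eq_integral_Ioc, Ioc_eq_empty (not_lt.2 h)]; simp

lemma path_of_le {r s : ℝ} (xhat φ : ℝ → E) (h : s ≤ r) : path r xhat φ s = xhat s := by
  simp [path, integral_Icc_of_le φ h, min_eq_left h]

lemma path_of_ge {r s : ℝ} (xhat φ : ℝ → E) (h : r ≤ s) :
    path r xhat φ s = xhat r + ∫ u in Icc r s, φ u := by
  simp [path, min_eq_right h]

lemma path_min {r : ℝ} (xhat φ : ℝ → E) :
    (fun s => path r xhat φ (min s r)) = fun s => xhat (min s r) := by
  funext s
  exact path_of_le _ _ (min_le_right _ _)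

lemma path_acDeriv {r T : ℝ} {xhat φ : ℝ → E} (hφ : IntegrableOn φ (Icc r T)) :
    IsACDeriv r T (path r xhat φ) φ := by
  refine ⟨hφ, fun t ht => ?_⟩
  rw [path_of_le _ _ le_rfl, path_of_ge _ _ ht.1]

lemma path_continuousOn {r T : ℝ} (hr : 0 ≤ r) (hrT : r < T) {xhat φ : ℝ → E}
    (hx : ContinuousOn xhat (Icc 0 T)) (hφ : IntegrableOn φ (Icc r T)) :
    ContinuousOn (path r xhat φ) (Icc 0 T) := by
  have h1 : ContinuousOn (fun s => xhat (min s r)) (Icc 0 T) := by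
    refine hx.comp (by fun_prop) fun s hs => ?_
    exact ⟨le_min hs.1 hr, (min_le_left _ _).trans hs.2⟩
  have h2 : ContinuousOn (fun s => ∫ u in Icc r (max s r), φ u) (Icc 0 T) := by
    refine (intervalIntegral.continuousOn_primitive_Icc hφ).comp
      (f := fun s => max s r) (by fun_prop) fun s hs => ?_
    exact ⟨le_max_right _ _, max_le hs.2 hrT.le⟩
  refine (h1.add h2).congr fun s hs => ?_
  change xhat (min s r) + ∫ u in Icc r s, φ u = xhat (min s r) + ∫ u in Icc r (max s r), φ u
  rcases le_total s r with h | h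
  · rw [max_eq_right h, integral_Icc_of_le φ h, integral_Icc_of_le φ le_rfl]
  · rw [max_eq_left h]

lemma supIcc_zero {a b : ℝ} (hab : a ≤ b) : supIcc a b (fun _ => (0 : E)) = 0 := by
  simp only [supIcc, norm_zero]
  rw [(nonempty_Icc.2 hab).image_const]
  simp

lemma supIcc_nonneg {a b : ℝ} (x : ℝ → E) : 0 ≤ supIcc a b x := by
  refine Real.sSup_nonneg ?_
  rintro _ ⟨s, _, rfl⟩
  exact norm_nonneg _

lemma hNorm_path {r T : ℝ} (xhat φ : ℝ → E) :
    hNorm r T (path r xhat φ) φ =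
      supIcc 0 T (fun s => xhat (min s r)) + Real.sqrt (∫ s in Icc r T, ‖φ s‖ ^ 2) := by
  rw [hNorm, path_min]

lemma hNorm_path_sub {r T : ℝ} (hT : 0 ≤ T) (xhat φ ψ : ℝ → E) :
    hNorm r T (fun s => path r xhat φ s - path r xhat ψ s) (fun s => φ s - ψ s) =
      Real.sqrt (∫ s in Icc r T, ‖φ s - ψ s‖ ^ 2) := by
  rw [hNorm]
  have : (fun s => path r xhat φ (min s r) - path r xhat ψ (min s r)) = fun _ => (0 : E) := by
    funext s
    rw [path_of_le _ _ (min_le_right _ _), path_of_le _ _ (min_le_right _ _), sub_self]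
  rw [this, supIcc_zero hT, zero_add]

/-- truncation at time `t` -/
lemma path_trunc {r t s : ℝ} (xhat φ : ℝ → E) (hs : s ≤ t) :
    path r xhat ((Iic t).indicator φ) s = path r xhat φ s := by
  simp only [path]
  congr 1
  refine setIntegral_congr_fun measurableSet_Icc fun u hu => ?_
  exact indicator_of_mem (show u ∈ Iic t from hu.2.trans hs) φ

lemma integral_trunc {r T t : ℝ} (ht : t ≤ T) (g : ℝ → ℝ) :
    ∫ s in Icc r T, (Iic t).indicator g s = ∫ s in Icc r t, g s := by
  rw [setIntegral_indicator measurableSet_Iic]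
  congr 2
  ext u; simp only [mem_inter_iff, mem_Icc, mem_Iic]
  constructor
  · rintro ⟨⟨a, _⟩, c⟩; exact ⟨a, c⟩
  · rintro ⟨a, c⟩; exact ⟨⟨a, c.trans ht⟩, c⟩

/-- growth bound -/
lemma growth {r T : ℝ} (hr : 0 ≤ r) (hrT : r < T) {F : ℝ → (ℝ → E) → E}
    (hna : NonAnticipative r T F) {c₀ : ℝ → ℝ}
    (hC : ∀ t ∈ Set.Icc r T, ∀ x x' : ℝ → E, ContinuousOn x (Set.Icc 0 T) → IsACDeriv r T x x' →
      ‖F t x‖ ≤ c₀ t * (1 + supIcc 0 T (fun s => x (min s r)) + ∫ s in Set.Icc r T, ‖x' s‖))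
    {xhat φ : ℝ → E} (hx : ContinuousOn xhat (Icc 0 T)) (hφ : IntegrableOn φ (Icc r T))
    {t : ℝ} (ht : t ∈ Icc r T) :
    ‖F t (path r xhat φ)‖ ≤
      c₀ t * (1 + supIcc 0 T (fun s => xhat (min s r)) + ∫ s in Icc r t, ‖φ s‖) := by
  have hφ' : IntegrableOn ((Iic t).indicator φ) (Icc r T) := hφ.indicator measurableSet_Iic
  have h := hC t ht _ _ (path_continuousOn hr hrT hx hφ') (path_acDeriv (xhat := xhat) hφ')
  rw [path_min] at h
  rw [hna t ht (path r xhat φ) (path r xhat ((Iic t).indicator φ))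
    (fun s hs => (path_trunc _ _ hs.2).symm)]
  simp only [norm_indicator_eq_indicator_norm] at h
  rwa [integral_trunc ht.2] at h

/-- `φ` is measurable and dominated by `B * c₀` on `[r,T]` -/
def Adm (r T : ℝ) (c₀ : ℝ → ℝ) (B : ℝ) (φ : ℝ → E) : Prop :=
  AEStronglyMeasurable φ (volume.restrict (Icc r T)) ∧ ∀ s ∈ Icc r T, ‖φ s‖ ≤ B * c₀ s

section adm
variable {r T : ℝ} {c₀ : ℝ → ℝ} {B : ℝ} {φ ψ : ℝ → E}

lemma integrable_of_sq {c : ℝ → ℝ} (hm : Measurable c)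
    (h2 : IntegrableOn (fun s => c s ^ 2) (Icc r T)) : IntegrableOn c (Icc r T) := by
  have : MemLp c 2 (volume.restrict (Icc r T)) :=
    (memLp_two_iff_integrable_sq hm.aestronglyMeasurable).2 h2
  exact this.integrable (by norm_num)

lemma Adm.integrableOn (h : Adm r T c₀ B φ) (hc : IntegrableOn c₀ (Icc r T)) :
    IntegrableOn φ (Icc r T) :=
  Integrable.mono' (hc.const_mul B) h.1
    ((ae_restrict_iff' measurableSet_Icc).2 (Eventually.of_forall h.2))

lemma Adm.sq_le (h : Adm r T c₀ B φ) {s : ℝ} (hs : s ∈ Icc r T) :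
    ‖φ s‖ ^ 2 ≤ B ^ 2 * c₀ s ^ 2 := by
  rw [← mul_pow]
  exact pow_le_pow_left₀ (norm_nonneg _) (h.2 s hs) 2

lemma Adm.sq_integrableOn (h : Adm r T c₀ B φ)
    (hc : IntegrableOn (fun s => c₀ s ^ 2) (Icc r T)) :
    IntegrableOn (fun s => ‖φ s‖ ^ 2) (Icc r T) := by
  refine Integrable.mono' (hc.const_mul (B ^ 2)) (h.1.norm.pow 2)
    ((ae_restrict_iff' measurableSet_Icc).2 (Eventually.of_forall fun s hs => ?_))
  rw [Real.norm_of_nonneg (by positivity)]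
  exact h.sq_le hs

lemma Adm.sub (h : Adm r T c₀ B φ) (h' : Adm r T c₀ B ψ) :
    Adm r T c₀ (2 * B) (fun s => φ s - ψ s) :=
  ⟨h.1.sub h'.1, fun s hs => (norm_sub_le _ _).trans (by linarith [h.2 s hs, h'.2 s hs])⟩

lemma Adm.mono (h : Adm r T c₀ B φ) (hc : ∀ s, 0 ≤ c₀ s) {B' : ℝ} (hB : B ≤ B') :
    Adm r T c₀ B' φ :=
  ⟨h.1, fun s hs => (h.2 s hs).trans (mul_le_mul_of_nonneg_right hB (hc s))⟩

lemma Adm.trunc (h : Adm r T c₀ B φ) (t : ℝ) : Adm r T c₀ B ((Iic t).indicator φ) :=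
  ⟨h.1.indicator measurableSet_Iic, fun s hs => (norm_indicator_le_norm_self _ _).trans (h.2 s hs)⟩

lemma Adm.memH1 (hr : 0 ≤ r) (hrT : r < T) (h : Adm r T c₀ B φ) (hcm : Measurable c₀)
    (hc : IntegrableOn (fun s => c₀ s ^ 2) (Icc r T)) {xhat : ℝ → E}
    (hx : ContinuousOn xhat (Icc 0 T)) : MemH1 r T (path r xhat φ) φ :=
  have hi := h.integrableOn (integrable_of_sq hcm hc)
  ⟨path_continuousOn hr hrT hx hi, path_acDeriv hi, h.sq_integrableOn hc⟩

lemma Adm.hNorm_le (h : Adm r T c₀ B φ)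
    (hc : IntegrableOn (fun s => c₀ s ^ 2) (Icc r T)) (xhat : ℝ → E) :
    hNorm r T (path r xhat φ) φ ≤ supIcc 0 T (fun s => xhat (min s r)) +
      Real.sqrt (B ^ 2 * ∫ s in Icc r T, c₀ s ^ 2) := by
  rw [hNorm_path, ← integral_const_mul]
  refine add_le_add le_rfl (Real.sqrt_le_sqrt ?_)
  exact setIntegral_mono_on (h.sq_integrableOn hc) (hc.const_mul _) measurableSet_Icc
    fun s hs => h.sq_le hs

/-- local Lipschitz bound along admissible derivatives -/
lemma lip (hr : 0 ≤ r) (hrT : r < T) {F : ℝ → (ℝ → E) → E}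
    (hna : NonAnticipative r T F) (hC2 : CondC2 r T F) (hcm : Measurable c₀)
    (hc : IntegrableOn (fun s => c₀ s ^ 2) (Icc r T)) {xhat : ℝ → E}
    (hx : ContinuousOn xhat (Icc 0 T)) (B : ℝ) :
    ∃ lam : ℝ → ℝ, Measurable lam ∧ (∀ s, 0 ≤ lam s) ∧
    IntegrableOn (fun s => lam s ^ 2) (Set.Icc r T) ∧
    ∀ φ ψ : ℝ → E, Adm r T c₀ B φ → Adm r T c₀ B ψ → ∀ t ∈ Icc r T,
      ‖F t (path r xhat φ) - F t (path r xhat ψ)‖ ≤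
        lam t * Real.sqrt (∫ s in Icc r t, ‖φ s - ψ s‖ ^ 2) := by
  obtain ⟨n, hn⟩ := exists_nat_ge (supIcc 0 T (fun s => xhat (min s r)) +
      Real.sqrt (B ^ 2 * ∫ s in Icc r T, c₀ s ^ 2))
  obtain ⟨lam, h1, h2, h3, h4⟩ := hC2 n
  refine ⟨lam, h1, h2, h3, fun φ ψ hφ hψ t ht => ?_⟩
  rw [hna t ht (path r xhat φ) (path r xhat ((Iic t).indicator φ))
    (fun s hs => (path_trunc _ _ hs.2).symm), hna t ht (path r xhat ψ)
    (path r xhat ((Iic t).indicator ψ)) (fun s hs => (path_trunc _ _ hs.2).symm)]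
  have h := h4 t ht _ _ _ _ ((hφ.trunc t).memH1 hr hrT hcm hc hx)
    ((hψ.trunc t).memH1 hr hrT hcm hc hx) (((hφ.trunc t).hNorm_le hc xhat).trans hn)
    (((hψ.trunc t).hNorm_le hc xhat).trans hn)
  rw [hNorm_path_sub (hr.trans hrT.le)] at h
  have h5 : (fun s => ‖(Iic t).indicator φ s - (Iic t).indicator ψ s‖ ^ 2) =
      (Iic t).indicator (fun s => ‖φ s - ψ s‖ ^ 2) := by
    funext s
    by_cases hs : s ∈ Iic t
    · simp [indicator_of_mem hs]
    · simp [indicator_of_notMem hs]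
  rwa [h5, integral_trunc ht.2] at h

end adm

lemma sq_of_le_mul_sqrt {a l I : ℝ} (ha : 0 ≤ a) (hI : 0 ≤ I)
    (h : a ≤ l * Real.sqrt I) : a ^ 2 ≤ l ^ 2 * I := by
  have := pow_le_pow_left₀ ha h 2
  rwa [mul_pow, Real.sq_sqrt hI] at this

section main
variable [MeasurableSpace E] [BorelSpace E] [SecondCountableTopology E]

lemma exists_fixed {r T : ℝ} (hr : 0 ≤ r) (hrT : r < T) {F : ℝ → (ℝ → E) → E}
    (hm : ProdMeasurable F)
    (hna : NonAnticipative r T F) (hC2 : CondC2 r T F) {c₀ : ℝ → ℝ} (hcm : Measurable c₀)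
    (hc0 : ∀ s, 0 ≤ c₀ s)
    (hc : IntegrableOn (fun s => c₀ s ^ 2) (Icc r T))
    (hC : ∀ t ∈ Set.Icc r T, ∀ x x' : ℝ → E, ContinuousOn x (Set.Icc 0 T) → IsACDeriv r T x x' →
      ‖F t x‖ ≤ c₀ t * (1 + supIcc 0 T (fun s => x (min s r)) + ∫ s in Set.Icc r T, ‖x' s‖))
    {xhat : ℝ → E} (hx : ContinuousOn xhat (Icc 0 T)) :
    ∃ (B : ℝ) (φ : ℝ → E), Adm r T c₀ B φ ∧ ∀ t ∈ Icc r T, φ t = F t (path r xhat φ) := by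
  have hci : IntegrableOn c₀ (Icc r T) := integrable_of_sq hcm hc
  set A : ℝ := 1 + supIcc 0 T (fun s => xhat (min s r)) with hA
  have hA0 : 0 ≤ A := by have := supIcc_nonneg (a := 0) (b := T) (fun s => xhat (min s r)); linarith
  let w : ℝ → ℝ := fun s => 2 * A * Real.exp (2 * ∫ u in Icc r s, c₀ u)
  set B : ℝ := w T with hB
  have hwB : ∀ s ∈ Icc r T, w s ≤ B := fun s hs => by
    have := setIntegral_Icc_mono hs.2 hci (fun u _ => hc0 u)
    exact mul_le_mul_of_nonneg_left (Real.exp_le_exp.2 (by linarith)) (by linarith)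
  have hmeas : ∀ x : ℝ → E, Measurable fun t => F t x := fun x =>
    Measurable.comp (g := fun p : ℝ × (ℝ → E) => F p.1 p.2) hm
      (measurable_id.prodMk measurable_const)
  have admOf : ∀ φ : ℝ → E, AEStronglyMeasurable φ (volume.restrict (Icc r T)) →
      (∀ s ∈ Icc r T, ‖φ s‖ ≤ c₀ s * w s) → Adm r T c₀ B φ := fun φ h1 h2 =>
    ⟨h1, fun s hs => (h2 s hs).trans (by
      rw [mul_comm]; exact mul_le_mul_of_nonneg_right (hwB s hs) (hc0 s))⟩
  let Φ : ℕ → ℝ → E := fun n => Nat.rec (fun _ => 0) (fun _ φ t => F t (path r xhat φ)) n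
  have hsucc : ∀ n t, Φ (n + 1) t = F t (path r xhat (Φ n)) := fun n t => rfl
  have hΦm : ∀ n, Measurable (Φ n) := fun n => by
    cases n with
    | zero => exact measurable_const
    | succ n => exact hmeas _
  have hΦb : ∀ n, ∀ s ∈ Icc r T, ‖Φ n s‖ ≤ c₀ s * w s := by
    intro n
    induction n with
    | zero =>
      intro s hs
      have : 0 ≤ c₀ s * w s := mul_nonneg (hc0 s) (by positivity)
      simpa [Φ] using this
    | succ n ih =>
      intro t ht
      have hadm := admOf (Φ n) (hΦm n).aestronglyMeasurable ih
      have hi := hadm.integrableOn hci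
      rw [hsucc]
      refine (growth hr hrT hna hC hx hi ht).trans (mul_le_mul_of_nonneg_left ?_ (hc0 t))
      have hsub : Icc r t ⊆ Icc r T := Icc_subset_Icc_right ht.2
      have h1 : ∫ s in Icc r t, ‖Φ n s‖ ≤
          ∫ s in Icc r t, (2 * A) * (c₀ s * Real.exp (2 * ∫ u in Icc r s, c₀ u)) := by
        refine setIntegral_mono_on (hi.mono_set hsub).norm
          (((expWeight_integrable 2 hci).mono_set hsub).const_mul _) measurableSet_Icc ?_
        intro s hs
        refine (ih s (hsub hs)).trans (le_of_eq ?_)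
        simp only [w]; ring
      rw [integral_const_mul] at h1
      have h2 := expWeight_le (β := 2) (by norm_num) hci hc0 ht
      have h3 := mul_le_mul_of_nonneg_left h2 (by linarith : 0 ≤ 2 * A)
      have h4 : 1 ≤ Real.exp (2 * ∫ u in Icc r t, c₀ u) :=
        Real.one_le_exp (mul_nonneg (by norm_num) (integral_nonneg hc0))
      have h5 := mul_le_mul_of_nonneg_left h4 hA0
      simp only [w]
      rw [← hA]
      nlinarith
  have hΦadm : ∀ n, Adm r T c₀ B (Φ n) := fun n =>
    admOf _ (hΦm n).aestronglyMeasurable (hΦb n)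
  obtain ⟨lam, hl1, hl2, hl3, hl4⟩ := lip hr hrT hna hC2 hcm hc hx B
  let d : ℕ → ℝ → ℝ := fun n s => ‖Φ (n + 1) s - Φ n s‖ ^ 2
  have hd := volterra_iter hl3 (fun s => sq_nonneg (lam s)) d
    (fun n => ((hΦadm (n + 1)).sub (hΦadm n)).sq_integrableOn hc)
    (fun n s => sq_nonneg _) (fun n t ht =>
      sq_of_le_mul_sqrt (norm_nonneg _) (integral_nonneg fun s => sq_nonneg _)
        (hl4 _ _ (hΦadm (n + 1)) (hΦadm n) t ht))
  set D : ℝ := ∫ s in Icc r T, d 0 s with hD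
  have hcauchy : ∀ t ∈ Icc r T, CauchySeq fun n => Φ (n + 1) t := by
    intro t ht
    set L : ℝ := Real.exp (4 * ∫ u in Icc r t, lam u ^ 2)
    refine cauchySeq_of_le_geometric (1 / 2) (lam t * Real.sqrt (D * L)) (by norm_num) fun n => ?_
    rw [dist_comm, dist_eq_norm]
    refine (hl4 _ _ (hΦadm (n + 1)) (hΦadm n) t ht).trans ?_
    rw [mul_assoc]
    refine mul_le_mul_of_nonneg_left ?_ (hl2 t)
    refine (Real.sqrt_le_sqrt (hd n t ht)).trans (le_of_eq ?_)
    rw [show D * (1 / 4) ^ n * L = (D * L) * ((1 / 2) ^ n) ^ 2 by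
      rw [← pow_mul, mul_comm n 2, pow_mul]; norm_num; ring]
    rw [Real.sqrt_mul' _ (by positivity), Real.sqrt_sq (by positivity)]
  have hex : ∀ t, ∃ a : E, t ∈ Icc r T → Tendsto (fun n => Φ (n + 1) t) atTop (𝓝 a) := by
    intro t
    by_cases ht : t ∈ Icc r T
    · obtain ⟨a, ha⟩ := cauchySeq_tendsto_of_complete (hcauchy t ht)
      exact ⟨a, fun _ => ha⟩
    · exact ⟨0, fun h => absurd h ht⟩
  choose φ hφ using hex
  have hφadm : Adm r T c₀ B φ := by
    refine ⟨aestronglyMeasurable_of_tendsto_ae atTop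
      (fun n => (hΦm (n + 1)).aestronglyMeasurable)
      ((ae_restrict_iff' measurableSet_Icc).2 (Eventually.of_forall hφ)), fun s hs => ?_⟩
    exact le_of_tendsto (hφ s hs).norm (Eventually.of_forall fun n => (hΦadm (n + 1)).2 s hs)
  refine ⟨B, φ, hφadm, fun t ht => ?_⟩
  have hlim : Tendsto (fun n => ∫ s in Icc r t, ‖Φ (n + 1) s - φ s‖ ^ 2) atTop (𝓝 0) := by
    have hsub : Icc r t ⊆ Icc r T := Icc_subset_Icc_right ht.2
    have := tendsto_integral_of_dominated_convergence (μ := volume.restrict (Icc r t))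
      (F := fun n s => ‖Φ (n + 1) s - φ s‖ ^ 2) (f := fun _ => (0 : ℝ))
      (fun s => (2 * B) ^ 2 * c₀ s ^ 2)
      (fun n => ((((hΦadm (n + 1)).sub hφadm).sq_integrableOn hc).mono_set hsub).1)
      ((hc.mono_set hsub).const_mul _)
      (fun n => (ae_restrict_iff' measurableSet_Icc).2 (Eventually.of_forall fun s hs => by
        rw [Real.norm_of_nonneg (by positivity)]
        exact ((hΦadm (n + 1)).sub hφadm).sq_le (hsub hs)))
      ((ae_restrict_iff' measurableSet_Icc).2 (Eventually.of_forall fun s hs => by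
        have h := (((hφ s (hsub hs)).sub_const (φ s)).norm).pow 2
        simpa using h))
    simpa using this
  have h1 : Tendsto (fun n => Φ (n + 2) t) atTop (𝓝 (F t (path r xhat φ))) := by
    rw [tendsto_iff_norm_sub_tendsto_zero]
    refine squeeze_zero (fun _ => norm_nonneg _)
      (fun n => hl4 _ _ (hΦadm (n + 1)) hφadm t ht) ?_
    have h := ((Real.continuous_sqrt.tendsto 0).comp hlim).const_mul (lam t)
    simpa using h
  exact tendsto_nhds_unique ((hφ t ht).comp (tendsto_add_atTop_nat 1)) h1

lemma fixed_unique {r T : ℝ} (hr : 0 ≤ r) (hrT : r < T) {F : ℝ → (ℝ → E) → E}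
    (hna : NonAnticipative r T F) (hC2 : CondC2 r T F) {c₀ : ℝ → ℝ} (hcm : Measurable c₀)
    (hc : IntegrableOn (fun s => c₀ s ^ 2) (Icc r T))
    {xhat : ℝ → E} (hx : ContinuousOn xhat (Icc 0 T)) {B : ℝ} {φ ψ : ℝ → E}
    (hφ : Adm r T c₀ B φ) (hψ : Adm r T c₀ B ψ)
    (hφe : ∀ t ∈ Icc r T, φ t = F t (path r xhat φ))
    (hψe : ∀ t ∈ Icc r T, ψ t = F t (path r xhat ψ)) : EqOn φ ψ (Icc r T) := by
  obtain ⟨lam, hl1, hl2, hl3, hl4⟩ := lip hr hrT hna hC2 hcm hc hx B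
  have hl5 : ∀ t ∈ Icc r T, ‖φ t - ψ t‖ ≤
      lam t * Real.sqrt (∫ s in Icc r t, ‖φ s - ψ s‖ ^ 2) := fun t ht => by
    conv_lhs => rw [hφe t ht, hψe t ht]
    exact hl4 _ _ hφ hψ t ht
  have hd := volterra_iter hl3 (fun s => sq_nonneg (lam s)) (fun _ s => ‖φ s - ψ s‖ ^ 2)
    (fun n => (hφ.sub hψ).sq_integrableOn hc)
    (fun n s => sq_nonneg _) (fun n t ht =>
      sq_of_le_mul_sqrt (norm_nonneg _) (integral_nonneg fun s => sq_nonneg _) (hl5 t ht))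
  intro t ht
  have h0 : ∫ s in Icc r t, ‖φ s - ψ s‖ ^ 2 ≤ 0 := by
    have hp : Tendsto (fun n : ℕ => ((1 : ℝ) / 4) ^ n) atTop (𝓝 0) :=
      tendsto_pow_atTop_nhds_zero_of_lt_one (by norm_num) (by norm_num)
    have hlim := (hp.const_mul (∫ s in Icc r T, ‖φ s - ψ s‖ ^ 2)).mul_const
      (Real.exp (4 * ∫ u in Icc r t, lam u ^ 2))
    rw [mul_zero, zero_mul] at hlim
    exact ge_of_tendsto hlim (Eventually.of_forall fun n => hd n t ht)
  have h1 := hl5 t ht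
  rw [Real.sqrt_eq_zero_of_nonpos h0, mul_zero] at h1
  exact sub_eq_zero.1 (norm_le_zero_iff.1 h1)

end main

end PathODE

/-- **Existence and uniqueness of mild solutions to path-dependent ODEs**
(Proposition 2.2 / Statement 0): under (C.1) and (C.2), the equation
`ẋ(t) = F(t,x)` on `[r,T]` has a unique mild solution with prescribed initial
segment `x̂` on `[0,r]`, and this solution belongs to `H¹_r([0,T],ℝ^m)`. -/
theorem mild_solution_exists_unique {m : ℕ} (r T : ℝ) (hr : 0 ≤ r) (hrT : r < T)
    (F : ℝ → (ℝ → EuclideanSpace ℝ (Fin m)) → EuclideanSpace ℝ (Fin m))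
    (hFmeas : ProdMeasurable F) (hFna : NonAnticipative r T F)
    (hC1 : CondC1 r T F) (hC2 : CondC2 r T F)
    (xhat : ℝ → EuclideanSpace ℝ (Fin m)) (hxhat : ContinuousOn xhat (Set.Icc 0 T)) :
    ∃ x : ℝ → EuclideanSpace ℝ (Fin m),
      IsMildSol r T F x ∧ (∀ s ∈ Set.Icc (0:ℝ) r, x s = xhat s) ∧
      (∃ x', MemH1 r T x x') ∧
      ∀ y : ℝ → EuclideanSpace ℝ (Fin m),
        IsMildSol r T F y → (∀ s ∈ Set.Icc (0:ℝ) r, y s = xhat s) →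
        Set.EqOn y x (Set.Icc 0 T) := by
  obtain ⟨c₀, hcm, hc0, hc, hC⟩ := hC1
  have hci : IntegrableOn c₀ (Icc r T) := PathODE.integrable_of_sq hcm hc
  obtain ⟨B, φ, hφ, hφe⟩ := PathODE.exists_fixed hr hrT hFmeas hFna hC2 hcm hc0 hc hC hxhat
  have hφi := hφ.integrableOn hci
  have hcongr : ∀ t ∈ Icc r T, ∫ s in Icc r t, F s (PathODE.path r xhat φ) =
      ∫ s in Icc r t, φ s := fun t ht =>
    setIntegral_congr_fun measurableSet_Icc fun s hs => (hφe s ⟨hs.1, hs.2.trans ht.2⟩).symm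
  refine ⟨PathODE.path r xhat φ, ⟨PathODE.path_continuousOn hr hrT hxhat hφi,
    hφi.congr_fun hφe measurableSet_Icc, fun t ht => ?_⟩,
    fun s hs => PathODE.path_of_le _ _ hs.2, ⟨φ, hφ.memH1 hr hrT hcm hc hxhat⟩, ?_⟩
  · rw [hcongr t ht]
    exact (PathODE.path_acDeriv hφi).2 t ht
  intro y hy hyx
  obtain ⟨hy1, hy2, hy3⟩ := hy
  let ψ : ℝ → EuclideanSpace ℝ (Fin m) := fun s => F s y
  have hψi : IntegrableOn ψ (Icc r T) := hy2
  have hyp : ∀ s ∈ Icc 0 T, y s = PathODE.path r xhat ψ s := by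
    intro s hs
    rcases le_total s r with h | h
    · rw [PathODE.path_of_le _ _ h, hyx s ⟨hs.1, h⟩]
    · rw [PathODE.path_of_ge _ _ h, hy3 s ⟨h, hs.2⟩, hyx r ⟨hr, le_rfl⟩]
  have hψe : ∀ t ∈ Icc r T, ψ t = F t (PathODE.path r xhat ψ) := fun t ht =>
    hFna t ht _ _ fun s hs => hyp s ⟨hs.1, hs.2.trans ht.2⟩
  have hψ : PathODE.Adm r T c₀ (1 + supIcc 0 T (fun s => xhat (min s r)) +
      ∫ s in Icc r T, ‖ψ s‖) ψ := by
    refine ⟨hψi.1, fun t ht => ?_⟩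
    rw [hψe t ht, mul_comm]
    refine (PathODE.growth hr hrT hFna hC hxhat hψi ht).trans
      (mul_le_mul_of_nonneg_left ?_ (hc0 t))
    have := PathODE.setIntegral_Icc_mono ht.2 hψi.norm (fun s _ => norm_nonneg (ψ s))
    linarith
  have heq := PathODE.fixed_unique hr hrT hFna hC2 hcm hc hxhat
    (hψ.mono hc0 (le_max_right B _)) (hφ.mono hc0 (le_max_left B _)) hψe hφe
  intro s hs
  rw [hyp s hs]
  simp only [PathODE.path]
  congr 1
  exact setIntegral_congr_fun measurableSet_Icc fun u hu => heq ⟨hu.1, hu.2.trans hs.2⟩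
end

section
/- Let F : [r,T] × C([0,T],ℝ^m) → ℝ^m be product measurable and non-anticipative, assume conditions (C.1) and (C.2) hold, and let x̂ ∈ C([0,T],ℝ^m). Define the Picard iterates x₀(t) := x̂(r∧t) and x_{n+1}(t) := x₀(t) + ∫_r^{r∨t} F(s,x_n) ds for n ∈ ℕ₀. Then each x_n lies in H¹_r([0,T],ℝ^m) and the sequence (x_n) converges in the delayed Cameron–Martin norm ‖·‖_{H,r} to the unique mild solution x of ẋ(t) = F(t,x) on [r,T] with x = x̂ on [0,r]. -/
open MeasureTheory Set Filter

section Aux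

set_option linter.unusedSectionVars false

/-- Path with given initial segment and derivative. -/
noncomputable def pth {E : Type*} [NormedAddCommGroup E] [NormedSpace ℝ E]
    (r : ℝ) (xhat : ℝ → E) (d : ℝ → E) : ℝ → E :=
  fun t => xhat (min r t) + ∫ s in Set.Icc r (max r t), d s

theorem exists_weight {r T : ℝ} (hrT : r ≤ T) (k : ℝ → ℝ) (hk0 : ∀ s, 0 ≤ k s)
    (hk : IntegrableOn k (Set.Icc r T)) :
    ∃ w : ℝ → ℝ, IntegrableOn (fun s => k s * w s) (Set.Icc r T) ∧
      (∀ t ∈ Set.Icc r T, 1 ≤ w t) ∧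
      ∀ t ∈ Set.Icc r T, ∫ s in Set.Icc r t, k s * w s ≤ w t - 1 := by
  have hki : IntervalIntegrable k volume r T :=
    (intervalIntegrable_iff_integrableOn_Icc_of_le hrT).2 hk
  have hc : ContinuousOn (fun t => ∫ s in r..t, k s) (Set.Icc r T) := by
    have := intervalIntegral.continuousOn_primitive_interval (μ := volume) (f := k) (a := r) (b := T)
      (by rwa [uIcc_of_le hrT])
    rwa [uIcc_of_le hrT] at this
  have hmono : MonotoneOn (fun t => ∫ s in r..t, k s) (Set.Icc r T) := by
    intro a ha b hb hab
    have h1 : IntervalIntegrable k volume r a := hki.mono_set (by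
      rw [uIcc_of_le hrT, uIcc_of_le ha.1]; exact Set.Icc_subset_Icc le_rfl ha.2)
    have h2 : IntervalIntegrable k volume a b := hki.mono_set (by
      rw [uIcc_of_le hrT, uIcc_of_le hab]; exact Set.Icc_subset_Icc ha.1 hb.2)
    have := intervalIntegral.integral_add_adjacent_intervals h1 h2
    have h3 : 0 ≤ ∫ s in a..b, k s := intervalIntegral.integral_nonneg hab (fun s _ => hk0 s)
    simp only
    linarith
  refine ⟨fun t => Real.exp (∫ s in r..t, k s), ?_, ?_, ?_⟩
  · exact hk.mul_continuousOn hc.rexp isCompact_Icc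
  · intro t ht
    rw [Real.one_le_exp_iff]
    exact intervalIntegral.integral_nonneg ht.1 (fun s _ => hk0 s)
  · intro t ht
    have hm : MonotoneOn (fun t => Real.exp (∫ s in r..t, k s)) (uIcc r t) := by
      rw [uIcc_of_le ht.1]
      intro a ha b hb hab
      exact Real.exp_le_exp.2 (hmono ⟨ha.1, ha.2.trans ht.2⟩ ⟨hb.1, hb.2.trans ht.2⟩ hab)
    have h := hm.intervalIntegral_deriv_mem_uIcc
    have hle := hm (by simp) (by simp : t ∈ uIcc r t) ht.1
    rw [uIcc_of_le (by linarith)] at h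
    have h2 := h.2
    simp only [intervalIntegral.integral_same, Real.exp_zero] at h2
    refine le_trans (le_of_eq ?_) h2
    rw [integral_Icc_eq_integral_Ioc, ← intervalIntegral.integral_of_le ht.1]
    apply intervalIntegral.integral_congr_ae
    filter_upwards [hki.ae_hasDerivAt_integral] with s hs hst
    rw [uIoc_of_le ht.1] at hst
    have := hs (by rw [uIcc_of_le hrT]; exact ⟨hst.1.le, hst.2.trans ht.2⟩) r (by simp)
    rw [this.exp.deriv, mul_comm]

theorem sq_setIntegral_le {r T t : ℝ} (hrT : r < T) (ht : t ∈ Set.Icc r T) (f : ℝ → ℝ)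
    (hf : IntegrableOn f (Set.Icc r t)) (hf2 : IntegrableOn (fun s => f s ^ 2) (Set.Icc r t)) :
    (∫ s in Set.Icc r t, f s) ^ 2 ≤ (T - r) * ∫ s in Set.Icc r t, f s ^ 2 := by
  set I := ∫ s in Set.Icc r t, f s with hI
  have hL : 0 < T - r := by linarith
  set c := I / (T - r) with hcdef
  have h0 : 0 ≤ ∫ s in Set.Icc r t, (f s ^ 2 - 2 * c * f s + c ^ 2) := by
    apply integral_nonneg
    intro s
    simp only [Pi.zero_apply]
    nlinarith [sq_nonneg (f s - c)]
  have hc : IntegrableOn (fun _ : ℝ => c ^ 2) (Set.Icc r t) := by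
    simp
  have hsplit : ∫ s in Set.Icc r t, (f s ^ 2 - 2 * c * f s + c ^ 2) =
      (∫ s in Set.Icc r t, f s ^ 2) - 2 * c * I + ∫ _ in Set.Icc r t, c ^ 2 := by
    have e1 : ∫ s in Set.Icc r t, (f s ^ 2 - 2 * c * f s + c ^ 2) =
      (∫ s in Set.Icc r t, (f s ^ 2 - 2 * c * f s)) + ∫ _ in Set.Icc r t, c ^ 2 :=
      integral_add (hf2.sub (hf.const_mul (2 * c))) hc
    have e2 : ∫ s in Set.Icc r t, (f s ^ 2 - 2 * c * f s) =
      (∫ s in Set.Icc r t, f s ^ 2) - ∫ s in Set.Icc r t, 2 * c * f s :=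
      integral_sub hf2 (hf.const_mul (2 * c))
    rw [e1, e2, integral_const_mul]
  rw [hsplit] at h0
  have hV : ∫ _ in Set.Icc r t, c ^ 2 = (t - r) * c ^ 2 := by
    simp [ht.1]
  rw [hV] at h0
  have h1 : (t - r) * c ^ 2 ≤ (T - r) * c ^ 2 :=
    mul_le_mul_of_nonneg_right (by linarith [ht.2]) (sq_nonneg c)
  have h2 : (T - r) * c = I := by rw [hcdef]; field_simp
  have h3 := mul_nonneg hL.le h0
  have h4 := mul_le_mul_of_nonneg_left h1 hL.le
  nlinarith

variable {E : Type*} [NormedAddCommGroup E] [NormedSpace ℝ E] [CompleteSpace E]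

theorem pth_continuousOn {r T : ℝ} (hr : 0 ≤ r) (hrT : r < T) {xhat d : ℝ → E}
    (hx : ContinuousOn xhat (Set.Icc 0 T)) (hd : IntegrableOn d (Set.Icc r T)) :
    ContinuousOn (pth r xhat d) (Set.Icc 0 T) := by
  unfold pth
  apply ContinuousOn.add
  · refine hx.comp (by fun_prop) ?_
    intro t ht
    exact ⟨le_min hr ht.1, (min_le_right _ _).trans ht.2⟩
  · refine (intervalIntegral.continuousOn_primitive_Icc hd).comp
      (f := fun t => max r t) (by fun_prop) ?_
    intro t ht
    exact ⟨le_max_left _ _, max_le hrT.le ht.2⟩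

theorem pth_of_le {r t : ℝ} {xhat d : ℝ → E} (h : t ≤ r) : pth r xhat d t = xhat t := by
  simp [pth, h]

theorem pth_of_ge {r t : ℝ} {xhat d : ℝ → E} (h : r ≤ t) :
    pth r xhat d t = xhat r + ∫ s in Set.Icc r t, d s := by
  simp [pth, h]

theorem pth_ac {r T : ℝ} {xhat d : ℝ → E} (hd : IntegrableOn d (Set.Icc r T)) :
    IsACDeriv r T (pth r xhat d) d := by
  refine ⟨hd, fun t ht => ?_⟩
  rw [pth_of_ge ht.1, pth_of_le le_rfl]

theorem pth_congr {r T : ℝ} {xhat d e : ℝ → E}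
    (h : d =ᵐ[volume.restrict (Set.Icc r T)] e) {t : ℝ} (hrT : r ≤ T) (ht : t ≤ T) :
    pth r xhat d t = pth r xhat e t := by
  unfold pth
  congr 1
  apply integral_congr_ae
  exact ae_restrict_of_ae_restrict_of_subset (Set.Icc_subset_Icc le_rfl (max_le hrT ht)) h

theorem pth_stop {r t : ℝ} {xhat d : ℝ → E} (hrt : r ≤ t) {s : ℝ} (hs : s ≤ t) :
    pth r xhat ((Set.Icc r t).indicator d) s = pth r xhat d s := by
  unfold pth
  congr 1
  rw [setIntegral_indicator measurableSet_Icc,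
    Set.inter_eq_left.2 (Set.Icc_subset_Icc le_rfl (max_le hrt hs))]

theorem pth_sup (r T : ℝ) (xhat d : ℝ → E) :
    supIcc 0 T (fun s => pth r xhat d (min s r)) = supIcc 0 T (fun s => xhat (min s r)) := by
  congr 1
  funext s
  exact pth_of_le (min_le_right _ _)

theorem supIcc_nonneg (a b : ℝ) (x : ℝ → E) : 0 ≤ supIcc a b x := by
  apply Real.sSup_nonneg
  rintro _ ⟨u, _, rfl⟩
  exact norm_nonneg _

theorem supIcc_zero (a b : ℝ) (x : ℝ → E) (h : ∀ s ∈ Set.Icc a b, x s = 0) :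
    supIcc a b x = 0 := by
  apply le_antisymm _ (supIcc_nonneg _ _ _)
  apply Real.sSup_nonpos
  rintro _ ⟨u, hu, rfl⟩
  simp [h u hu]

theorem memLp_ind {r T t : ℝ} {d : ℝ → E} (hd : MemLp d 2 (volume.restrict (Set.Icc r T))) :
    MemLp ((Set.Icc r t).indicator d) 2 (volume.restrict (Set.Icc r T)) :=
  hd.indicator measurableSet_Icc

theorem memLp_int {r T : ℝ} {d : ℝ → E} (hd : MemLp d 2 (volume.restrict (Set.Icc r T))) :
    IntegrableOn d (Set.Icc r T) :=
  hd.integrable (by norm_num)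

theorem memLp_sq {r T : ℝ} {d : ℝ → E} (hd : MemLp d 2 (volume.restrict (Set.Icc r T))) :
    IntegrableOn (fun s => ‖d s‖ ^ 2) (Set.Icc r T) :=
  (memLp_two_iff_integrable_sq_norm hd.1).1 hd

theorem pth_memH1 {r T : ℝ} (hr : 0 ≤ r) (hrT : r < T) {xhat d : ℝ → E}
    (hx : ContinuousOn xhat (Set.Icc 0 T)) (hd : MemLp d 2 (volume.restrict (Set.Icc r T))) :
    MemH1 r T (pth r xhat d) d :=
  ⟨pth_continuousOn hr hrT hx (memLp_int hd), pth_ac (memLp_int hd), memLp_sq hd⟩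

/-- integral of a function of a stopped derivative -/
theorem int_ind {r T t : ℝ} (ht : t ∈ Set.Icc r T) (d : ℝ → E) (φ : E → ℝ) (h0 : φ 0 = 0) :
    ∫ s in Set.Icc r T, φ ((Set.Icc r t).indicator d s) = ∫ s in Set.Icc r t, φ (d s) := by
  have : (fun s => φ ((Set.Icc r t).indicator d s)) = (Set.Icc r t).indicator (fun s => φ (d s)) := by
    funext s
    by_cases hs : s ∈ Set.Icc r t <;> simp [hs, h0]
  rw [this, setIntegral_indicator measurableSet_Icc,
    Set.inter_eq_right.2 (Set.Icc_subset_Icc le_rfl ht.2)]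

theorem growth {r T : ℝ} (hr : 0 ≤ r) (hrT : r < T) {F : ℝ → (ℝ → E) → E}
    (hFna : NonAnticipative r T F) {xhat : ℝ → E} (hx : ContinuousOn xhat (Set.Icc 0 T))
    {c : ℝ → ℝ}
    (hc : ∀ t ∈ Set.Icc r T, ∀ x x' : ℝ → E, ContinuousOn x (Set.Icc 0 T) → IsACDeriv r T x x' →
      ‖F t x‖ ≤ c t * (1 + supIcc 0 T (fun s => x (min s r)) + ∫ s in Set.Icc r T, ‖x' s‖))
    {d : ℝ → E} (hd : IntegrableOn d (Set.Icc r T)) {t : ℝ} (ht : t ∈ Set.Icc r T) :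
    ‖F t (pth r xhat d)‖ ≤
      c t * (1 + supIcc 0 T (fun s => xhat (min s r)) + ∫ s in Set.Icc r t, ‖d s‖) := by
  have hi : IntegrableOn ((Set.Icc r t).indicator d) (Set.Icc r T) :=
    hd.indicator measurableSet_Icc
  have h := hc t ht _ _ (pth_continuousOn hr hrT hx hi) (pth_ac hi)
  rw [pth_sup, int_ind ht d (fun v => ‖v‖) norm_zero] at h
  rwa [hFna t ht _ (pth r xhat d) (fun s hs => pth_stop ht.1 hs.2)] at h

theorem growth_sq {r T : ℝ} (hr : 0 ≤ r) (hrT : r < T) {F : ℝ → (ℝ → E) → E}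
    (hFna : NonAnticipative r T F) {xhat : ℝ → E} (hx : ContinuousOn xhat (Set.Icc 0 T))
    {c : ℝ → ℝ}
    (hc : ∀ t ∈ Set.Icc r T, ∀ x x' : ℝ → E, ContinuousOn x (Set.Icc 0 T) → IsACDeriv r T x x' →
      ‖F t x‖ ≤ c t * (1 + supIcc 0 T (fun s => x (min s r)) + ∫ s in Set.Icc r T, ‖x' s‖))
    {d : ℝ → E} (hd : MemLp d 2 (volume.restrict (Set.Icc r T))) {t : ℝ} (ht : t ∈ Set.Icc r T) :
    ‖F t (pth r xhat d)‖ ^ 2 ≤ (2 * (1 + (T - r)) * c t ^ 2) *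
      ((1 + supIcc 0 T (fun s => xhat (min s r))) ^ 2 + ∫ s in Set.Icc r t, ‖d s‖ ^ 2) := by
  have h := growth hr hrT hFna hx hc (memLp_int hd) ht
  have hsub : Set.Icc r t ⊆ Set.Icc r T := Set.Icc_subset_Icc le_rfl ht.2
  have hcs := sq_setIntegral_le hrT ht (fun s => ‖d s‖) ((memLp_int hd).mono_set hsub).norm
    ((memLp_sq hd).mono_set hsub)
  have hq : 0 ≤ ∫ s in Set.Icc r t, ‖d s‖ ^ 2 := integral_nonneg (fun s => by positivity)
  set A := 1 + supIcc 0 T (fun s => xhat (min s r))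
  set I := ∫ s in Set.Icc r t, ‖d s‖
  set Q := ∫ s in Set.Icc r t, ‖d s‖ ^ 2
  have h2 : ‖F t (pth r xhat d)‖ ^ 2 ≤ (c t * (A + I)) ^ 2 :=
    pow_le_pow_left₀ (norm_nonneg _) h 2
  have h3 : (A + I) ^ 2 ≤ 2 * (1 + (T - r)) * (A ^ 2 + Q) := by
    have : 0 ≤ (T - r) * A ^ 2 := mul_nonneg (by linarith) (sq_nonneg _)
    nlinarith [sq_nonneg (A - I)]
  calc _ ≤ _ := h2
    _ = c t ^ 2 * (A + I) ^ 2 := by ring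
    _ ≤ c t ^ 2 * (2 * (1 + (T - r)) * (A ^ 2 + Q)) :=
      mul_le_mul_of_nonneg_left h3 (sq_nonneg _)
    _ = _ := by ring

theorem lip_sq {r T : ℝ} (hr : 0 ≤ r) (hrT : r < T) {F : ℝ → (ℝ → E) → E}
    (hFna : NonAnticipative r T F) {xhat : ℝ → E} (hx : ContinuousOn xhat (Set.Icc 0 T))
    (hC2 : CondC2 r T F) (R : ℝ) :
    ∃ k : ℝ → ℝ, (∀ s, 0 ≤ k s) ∧ IntegrableOn k (Set.Icc r T) ∧
      ∀ d e : ℝ → E, MemLp d 2 (volume.restrict (Set.Icc r T)) →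
        MemLp e 2 (volume.restrict (Set.Icc r T)) →
        ∫ s in Set.Icc r T, ‖d s‖ ^ 2 ≤ R → ∫ s in Set.Icc r T, ‖e s‖ ^ 2 ≤ R →
        ∀ t ∈ Set.Icc r T, ‖F t (pth r xhat d) - F t (pth r xhat e)‖ ^ 2 ≤
          k t * ∫ s in Set.Icc r t, ‖d s - e s‖ ^ 2 := by
  set A := supIcc 0 T (fun s => xhat (min s r)) with hA
  obtain ⟨n, hn⟩ := exists_nat_ge (A + Real.sqrt R)
  obtain ⟨lam, -, hl0, hl2, hl⟩ := hC2 n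
  refine ⟨fun s => lam s ^ 2, fun s => sq_nonneg _, hl2, ?_⟩
  intro d e hd he hdR heR t ht
  have key : ∀ d : ℝ → E, MemLp d 2 (volume.restrict (Set.Icc r T)) →
      ∫ s in Set.Icc r T, ‖d s‖ ^ 2 ≤ R →
      hNorm r T (pth r xhat ((Set.Icc r t).indicator d)) ((Set.Icc r t).indicator d) ≤ n := by
    intro d hd hdR
    refine le_trans ?_ hn
    unfold hNorm
    rw [pth_sup]
    gcongr
    rw [int_ind ht d (fun v => ‖v‖ ^ 2) (by simp)]
    exact (setIntegral_mono_set (memLp_sq hd) (ae_of_all _ fun s => by positivity)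
      (Set.Icc_subset_Icc le_rfl ht.2).eventuallyLE).trans hdR
  have h := hl t ht _ _ _ _ (pth_memH1 hr hrT hx (memLp_ind (t := t) hd))
    (pth_memH1 hr hrT hx (memLp_ind (t := t) he)) (key d hd hdR) (key e he heR)
  rw [hFna t ht _ (pth r xhat d) (fun s hs => pth_stop ht.1 hs.2),
    hFna t ht _ (pth r xhat e) (fun s hs => pth_stop ht.1 hs.2)] at h
  have hN : hNorm r T (fun s => pth r xhat ((Set.Icc r t).indicator d) s -
      pth r xhat ((Set.Icc r t).indicator e) s)
      (fun s => (Set.Icc r t).indicator d s - (Set.Icc r t).indicator e s) =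
      Real.sqrt (∫ s in Set.Icc r t, ‖d s - e s‖ ^ 2) := by
    unfold hNorm
    rw [supIcc_zero, zero_add]
    · congr 1
      rw [← int_ind ht (fun s => d s - e s) (fun v => ‖v‖ ^ 2) (by simp)]
      congr 1
      funext s
      by_cases hs : s ∈ Set.Icc r t <;> simp [hs]
    · intro s _
      beta_reduce
      rw [pth_of_le (min_le_right _ _), pth_of_le (min_le_right _ _), sub_self]
  rw [hN] at h
  calc _ ≤ _ := pow_le_pow_left₀ (norm_nonneg _) h 2
    _ = _ := by rw [mul_pow, Real.sq_sqrt (integral_nonneg fun s => by positivity)]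

theorem l2_norm {μ : Measure ℝ} {f : ℝ → E} (hf : MemLp f 2 μ) :
    ‖hf.toLp f‖ = Real.sqrt (∫ s, ‖f s‖ ^ 2 ∂μ) := by
  rw [Lp.norm_toLp, hf.eLpNorm_eq_integral_rpow_norm (by norm_num) (by norm_num),
    ENNReal.toReal_ofReal (by positivity), Real.sqrt_eq_rpow]
  simp

theorem l2_dist {μ : Measure ℝ} {f g : ℝ → E} (hf : MemLp f 2 μ) (hg : MemLp g 2 μ) :
    dist (hf.toLp f) (hg.toLp g) = Real.sqrt (∫ s, ‖f s - g s‖ ^ 2 ∂μ) := by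
  rw [dist_eq_norm, ← MemLp.toLp_sub, l2_norm]
  rfl

/-- one step of the weighted estimate -/
theorem weight_step {r T : ℝ} {k w : ℝ → ℝ} (hk0 : ∀ s, 0 ≤ k s)
    (hkw : IntegrableOn (fun s => k s * w s) (Set.Icc r T))
    (hw : ∀ t ∈ Set.Icc r T, ∫ s in Set.Icc r t, k s * w s ≤ w t - 1)
    {M : ℝ} (hM : 0 ≤ M) {f U : ℝ → ℝ} (hf : IntegrableOn f (Set.Icc r T))
    (hfU : ∀ s ∈ Set.Icc r T, f s ≤ k s * U s) (hU : ∀ s ∈ Set.Icc r T, U s ≤ M * w s)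
    {t : ℝ} (ht : t ∈ Set.Icc r T) :
    ∫ s in Set.Icc r t, f s ≤ M * (w t - 1) := by
  have hsub : Set.Icc r t ⊆ Set.Icc r T := Set.Icc_subset_Icc le_rfl ht.2
  calc _ ≤ ∫ s in Set.Icc r t, M * (k s * w s) := by
        apply setIntegral_mono_on (hf.mono_set hsub) ((hkw.mono_set hsub).const_mul _)
          measurableSet_Icc
        intro s hs
        have := mul_le_mul_of_nonneg_left (hU s (hsub hs)) (hk0 s)
        calc _ ≤ _ := hfU s (hsub hs)
          _ ≤ _ := this
          _ = _ := by ring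
    _ = M * ∫ s in Set.Icc r t, k s * w s := integral_const_mul _ _
    _ ≤ _ := mul_le_mul_of_nonneg_left (hw t ht) hM

theorem ae_eq_of_primitive {r T : ℝ} (hrT : r ≤ T) {d e : ℝ → E}
    (hd : IntegrableOn d (Set.Icc r T)) (he : IntegrableOn e (Set.Icc r T))
    (h : ∀ t ∈ Set.Icc r T, ∫ s in Set.Icc r t, d s = ∫ s in Set.Icc r t, e s) :
    d =ᵐ[volume.restrict (Set.Icc r T)] e := by
  have hdi := (intervalIntegrable_iff_integrableOn_Icc_of_le hrT).2 hd
  have hei := (intervalIntegrable_iff_integrableOn_Icc_of_le hrT).2 he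
  rw [← restrict_Ioo_eq_restrict_Icc, Filter.EventuallyEq, ae_restrict_iff' measurableSet_Ioo]
  filter_upwards [hdi.ae_hasDerivAt_integral, hei.ae_hasDerivAt_integral] with s h1 h2 hs
  have hs' : s ∈ uIcc r T := by rw [uIcc_of_le hrT]; exact ⟨hs.1.le, hs.2.le⟩
  have h1 := h1 hs' r (by simp)
  have h2 := h2 hs' r (by simp)
  refine h1.unique (h2.congr_of_eventuallyEq ?_)
  filter_upwards [Icc_mem_nhds hs.1 hs.2] with t ht
  rw [intervalIntegral.integral_of_le ht.1, intervalIntegral.integral_of_le ht.1,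
    ← integral_Icc_eq_integral_Ioc, ← integral_Icc_eq_integral_Ioc, h t ht]

end Aux

set_option maxHeartbeats 1000000 in
/-- **Picard iteration for path-dependent ODEs** (Statement 1): under (C.1) and (C.2),
the Picard iterates `x₀(t) = x̂(r∧t)`, `x_{n+1}(t) = x₀(t) + ∫_r^{r∨t} F(s,x_n) ds` all lie
in `H¹_r([0,T],ℝ^m)` and converge in the delayed Cameron–Martin norm to the unique mild
solution `x` of `ẋ(t) = F(t,x)` on `[r,T]` with `x = x̂` on `[0,r]`. -/
theorem picard_iterates_converge {m : ℕ} (r T : ℝ) (hr : 0 ≤ r) (hrT : r < T)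
    (F : ℝ → (ℝ → EuclideanSpace ℝ (Fin m)) → EuclideanSpace ℝ (Fin m))
    (hFmeas : ProdMeasurable F) (hFna : NonAnticipative r T F)
    (hC1 : CondC1 r T F) (hC2 : CondC2 r T F)
    (xhat : ℝ → EuclideanSpace ℝ (Fin m)) (hxhat : ContinuousOn xhat (Set.Icc 0 T))
    (xseq : ℕ → ℝ → EuclideanSpace ℝ (Fin m))
    (hx0 : ∀ t, xseq 0 t = xhat (min r t))
    (hxrec : ∀ n t, xseq (n + 1) t = xseq 0 t + ∫ s in Set.Icc r (max r t), F s (xseq n)) :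
    (∀ n, ∃ d, MemH1 r T (xseq n) d) ∧
    ∃ x x' : ℝ → EuclideanSpace ℝ (Fin m),
      IsMildSol r T F x ∧ (∀ s ∈ Set.Icc (0:ℝ) r, x s = xhat s) ∧ MemH1 r T x x' ∧
      (∀ y : ℝ → EuclideanSpace ℝ (Fin m),
        IsMildSol r T F y → (∀ s ∈ Set.Icc (0:ℝ) r, y s = xhat s) →
        Set.EqOn y x (Set.Icc 0 T)) ∧
      ∀ dseq : ℕ → ℝ → EuclideanSpace ℝ (Fin m), (∀ n, MemH1 r T (xseq n) (dseq n)) →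
        Filter.Tendsto
          (fun n => hNorm r T (fun t => xseq n t - x t) (fun t => dseq n t - x' t))
          Filter.atTop (nhds 0) := by
  obtain ⟨c, hcm, hc0, hc2, hc⟩ := hC1
  set μ := volume.restrict (Set.Icc r T) with hμ
  set A := supIcc 0 T (fun s => xhat (min s r)) with hA
  have hTmem : T ∈ Set.Icc r T := ⟨hrT.le, le_rfl⟩
  -- measurability and square integrability
  have hmeas : ∀ x : ℝ → EuclideanSpace ℝ (Fin m), Measurable (fun s => F s x) := fun x =>
    hFmeas.comp (measurable_id.prodMk measurable_const)
  have hcL : MemLp c 2 μ := (memLp_two_iff_integrable_sq hcm.aestronglyMeasurable).2 hc2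
  have hPhi : ∀ d : ℝ → EuclideanSpace ℝ (Fin m), IntegrableOn d (Set.Icc r T) →
      MemLp (fun s => F s (pth r xhat d)) 2 μ := by
    intro d hd
    refine (hcL.mul_const (1 + A + ∫ s in Set.Icc r T, ‖d s‖)).of_le
      (hmeas _).aestronglyMeasurable ?_
    rw [hμ, ae_restrict_iff' measurableSet_Icc]
    refine ae_of_all _ fun t ht => ?_
    have h1 := growth hr hrT hFna hxhat hc hd ht
    have h2 : ∫ s in Set.Icc r t, ‖d s‖ ≤ ∫ s in Set.Icc r T, ‖d s‖ :=
      setIntegral_mono_set hd.norm (ae_of_all _ fun s => norm_nonneg _)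
        (Set.Icc_subset_Icc le_rfl ht.2).eventuallyLE
    refine h1.trans (le_trans ?_ (Real.le_norm_self _))
    exact mul_le_mul_of_nonneg_left (by linarith) (hc0 t)
  -- derivatives of the iterates
  obtain ⟨d, hd0, hd1⟩ : ∃ d : ℕ → ℝ → EuclideanSpace ℝ (Fin m),
      (d 0 = fun _ => 0) ∧ ∀ n, d (n + 1) = fun s => F s (xseq n) :=
    ⟨fun n => Nat.rec (fun _ => 0) (fun n _ => fun s => F s (xseq n)) n, rfl, fun _ => rfl⟩
  have hxd : ∀ n, xseq n = pth r xhat (d n) := by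
    intro n
    cases n with
    | zero => funext t; simp [pth, hd0, hx0]
    | succ n => funext t; rw [hxrec, hx0, hd1]; rfl
  have hdsucc : ∀ n, d (n + 1) = fun s => F s (pth r xhat (d n)) := by
    intro n
    rw [← hxd n, hd1]
  have hdL : ∀ n, MemLp (d n) 2 μ := by
    intro n
    induction n with
    | zero => rw [hd0]; exact MemLp.zero
    | succ n ih => rw [hdsucc]; exact hPhi _ (memLp_int ih)
  refine ⟨fun n => ⟨d n, by rw [hxd n]; exact pth_memH1 hr hrT hxhat (hdL n)⟩, ?_⟩
  -- uniform bound
  have hbound : ∃ R : ℝ, ∀ n, ∫ s in Set.Icc r T, ‖d n s‖ ^ 2 ≤ R := by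
    have hk0 : ∀ s, 0 ≤ 2 * (1 + (T - r)) * c s ^ 2 := fun s =>
      mul_nonneg (by linarith) (sq_nonneg _)
    obtain ⟨w, hkw, hw1, hw⟩ := exists_weight hrT.le (fun s => 2 * (1 + (T - r)) * c s ^ 2) hk0
      (hc2.const_mul _)
    have key : ∀ n, ∀ t ∈ Set.Icc r T,
        ∫ s in Set.Icc r t, ‖d n s‖ ^ 2 ≤ (1 + A) ^ 2 * (w t - 1) := by
      intro n
      induction n with
      | zero =>
        intro t ht
        have : 0 ≤ (1 + A) ^ 2 * (w t - 1) :=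
          mul_nonneg (sq_nonneg _) (by linarith [hw1 t ht])
        simpa [hd0] using this
      | succ n ih =>
        intro t ht
        refine weight_step (U := fun t => (1 + A) ^ 2 + ∫ s in Set.Icc r t, ‖d n s‖ ^ 2)
          hk0 hkw hw (sq_nonneg _) (memLp_sq (hdL (n + 1))) ?_ ?_ ht
        · intro s hs
          rw [hdsucc]
          exact growth_sq hr hrT hFna hxhat hc (hdL n) hs
        · intro s hs
          have := ih s hs
          linarith
    exact ⟨_, fun n => key n T hTmem⟩
  obtain ⟨R, hR⟩ := hbound
  -- weighted contraction
  have contr : ∀ R : ℝ, ∃ w : ℝ → ℝ, (∀ t ∈ Set.Icc r T, 1 ≤ w t) ∧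
      ∀ f g f' g' : ℝ → EuclideanSpace ℝ (Fin m), MemLp f 2 μ → MemLp g 2 μ →
        MemLp f' 2 μ → MemLp g' 2 μ →
        (∀ᵐ s ∂μ, f' s = F s (pth r xhat f)) → (∀ᵐ s ∂μ, g' s = F s (pth r xhat g)) →
        ∫ s in Set.Icc r T, ‖f s‖ ^ 2 ≤ R → ∫ s in Set.Icc r T, ‖g s‖ ^ 2 ≤ R →
        ∀ M : ℝ, 0 ≤ M →
        (∀ t ∈ Set.Icc r T, ∫ s in Set.Icc r t, ‖f s - g s‖ ^ 2 ≤ M * w t) →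
        (∀ t ∈ Set.Icc r T, ∫ s in Set.Icc r t, ‖f' s - g' s‖ ^ 2 ≤ M * (1 / 4) * w t) := by
    intro R
    obtain ⟨k, hk0, hk, hlip⟩ := lip_sq hr hrT hFna hxhat hC2 R
    have hk4 : ∀ s, 0 ≤ 4 * k s := fun s => by linarith [hk0 s]
    obtain ⟨w, hkw, hw1, hw⟩ := exists_weight hrT.le (fun s => 4 * k s) hk4 (hk.const_mul 4)
    refine ⟨w, hw1, ?_⟩
    intro f g f' g' hf hg hf' hg' hff hgg hfR hgR M hM hfg t ht
    have hst : ∫ s in Set.Icc r t, ‖f' s - g' s‖ ^ 2 =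
        ∫ s in Set.Icc r t, ‖F s (pth r xhat f) - F s (pth r xhat g)‖ ^ 2 := by
      apply integral_congr_ae
      have hsub : Set.Icc r t ⊆ Set.Icc r T := Set.Icc_subset_Icc le_rfl ht.2
      filter_upwards [ae_restrict_of_ae_restrict_of_subset hsub hff,
        ae_restrict_of_ae_restrict_of_subset hsub hgg] with s h1 h2
      rw [h1, h2]
    rw [hst]
    have h := weight_step (M := M * (1 / 4))
      (f := fun s => ‖F s (pth r xhat f) - F s (pth r xhat g)‖ ^ 2)
      (U := fun t => (1 / 4) * ∫ s in Set.Icc r t, ‖f s - g s‖ ^ 2)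
      hk4 hkw hw (by positivity)
      (memLp_sq ((hPhi f (memLp_int hf)).sub (hPhi g (memLp_int hg)))) ?_ ?_ ht
    · refine h.trans ?_
      exact mul_le_mul_of_nonneg_left (by linarith) (by positivity)
    · intro s hs
      have := hlip f g hf hg hfR hgR s hs
      linarith
    · intro s hs
      have := hfg s hs
      linarith
  have mono_t : ∀ f : ℝ → EuclideanSpace ℝ (Fin m), MemLp f 2 μ → ∀ t ∈ Set.Icc r T,
      ∫ s in Set.Icc r t, ‖f s‖ ^ 2 ≤ ∫ s in Set.Icc r T, ‖f s‖ ^ 2 := fun f hf t ht =>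
    setIntegral_mono_set (memLp_sq hf) (ae_of_all _ fun s => by positivity)
      (Set.Icc_subset_Icc le_rfl ht.2).eventuallyLE
  have sq0 : ∀ f : ℝ → EuclideanSpace ℝ (Fin m), 0 ≤ ∫ s in Set.Icc r T, ‖f s‖ ^ 2 := fun f =>
    integral_nonneg fun s => by positivity
  -- Cauchy
  have hcau : CauchySeq (fun n => (hdL n).toLp (d n)) := by
    obtain ⟨w, hw1, hw⟩ := contr R
    set M := ∫ s in Set.Icc r T, ‖d 0 s - d 1 s‖ ^ 2 with hMdef
    have hM : 0 ≤ M := sq0 (fun s => d 0 s - d 1 s)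
    have key : ∀ n, ∀ t ∈ Set.Icc r T,
        ∫ s in Set.Icc r t, ‖d n s - d (n + 1) s‖ ^ 2 ≤ M * (1 / 4) ^ n * w t := by
      intro n
      induction n with
      | zero =>
        intro t ht
        have h1 := mono_t (fun s => d 0 s - d 1 s) ((hdL 0).sub (hdL 1)) t ht
        have h2 := mul_le_mul_of_nonneg_left (hw1 t ht) hM
        simp only [pow_zero, mul_one, zero_add]
        linarith
      | succ n ih =>
        intro t ht
        have h := hw (d n) (d (n + 1)) (d (n + 1)) (d (n + 2)) (hdL _) (hdL _) (hdL _) (hdL _)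
          (ae_of_all _ fun s => by rw [hdsucc]) (ae_of_all _ fun s => by rw [hdsucc (n + 1)])
          (hR _) (hR _) (M * (1 / 4) ^ n) (by positivity) ih t ht
        rwa [pow_succ, ← mul_assoc]
    refine cauchySeq_of_le_geometric (1 / 2) (Real.sqrt (M * w T)) (by norm_num) fun n => ?_
    rw [l2_dist]
    have h := Real.sqrt_le_sqrt (key n T hTmem)
    refine h.trans (le_of_eq ?_)
    have e : M * (1 / 4) ^ n * w T = M * w T * ((1 / 2) ^ n) ^ 2 := by
      rw [← pow_mul, mul_comm n 2, pow_mul]; norm_num; ring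
    rw [e, Real.sqrt_mul (mul_nonneg hM (by linarith [hw1 T hTmem])),
      Real.sqrt_sq (by positivity)]
  obtain ⟨L, hL⟩ := cauchySeq_tendsto_of_complete hcau
  obtain ⟨D, hDL, rfl⟩ : ∃ (D : ℝ → EuclideanSpace ℝ (Fin m)) (hD : MemLp D 2 μ),
      hD.toLp D = L := ⟨L, Lp.memLp L, Lp.toLp_coeFn L _⟩
  have hlim : Tendsto (fun n => Real.sqrt (∫ s in Set.Icc r T, ‖d n s - D s‖ ^ 2))
      atTop (nhds 0) := by
    have := tendsto_iff_dist_tendsto_zero.1 hL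
    simpa only [l2_dist] using this
  -- fixed point
  have hfix : D =ᵐ[μ] fun s => F s (pth r xhat D) := by
    set R' := max R (∫ s in Set.Icc r T, ‖D s‖ ^ 2) with hR'
    obtain ⟨k, hk0, hk, hlip⟩ := lip_sq hr hrT hFna hxhat hC2 R'
    have hPD := hPhi D (memLp_int hDL)
    rw [← MemLp.toLp_eq_toLp_iff hDL hPD]
    refine tendsto_nhds_unique (hL.comp (tendsto_add_atTop_nat 1)) ?_
    rw [tendsto_iff_dist_tendsto_zero]
    refine squeeze_zero (fun n => dist_nonneg) (g := fun n =>
      Real.sqrt (∫ s in Set.Icc r T, k s) * Real.sqrt (∫ s in Set.Icc r T, ‖d n s - D s‖ ^ 2)) ?_ ?_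
    · intro n
      simp only [Function.comp]
      rw [l2_dist, ← Real.sqrt_mul (integral_nonneg hk0)]
      apply Real.sqrt_le_sqrt
      rw [← integral_mul_const]
      apply setIntegral_mono_on (memLp_sq ((hdL (n + 1)).sub hPD)) (hk.mul_const _)
        measurableSet_Icc
      intro s hs
      simp only [hdsucc]
      refine (hlip (d n) D (hdL n) hDL ((hR n).trans (le_max_left _ _)) (le_max_right _ _)
        s hs).trans ?_
      exact mul_le_mul_of_nonneg_left
        (mono_t (fun s => d n s - D s) ((hdL n).sub hDL) s hs) (hk0 s)
    · simpa using hlim.const_mul (Real.sqrt (∫ s in Set.Icc r T, k s))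
  refine ⟨pth r xhat D, D, ⟨pth_continuousOn hr hrT hxhat (memLp_int hDL),
    memLp_int (hPhi D (memLp_int hDL)), ?_⟩, fun s hs => pth_of_le hs.2,
    pth_memH1 hr hrT hxhat hDL, ?_, ?_⟩
  · intro t ht
    rw [pth_of_ge ht.1, pth_of_le le_rfl]
    congr 1
    apply integral_congr_ae
    exact ae_restrict_of_ae_restrict_of_subset (Set.Icc_subset_Icc le_rfl ht.2) hfix
  · -- uniqueness
    intro y hy hyx
    obtain ⟨hyc, hyi, hye⟩ := hy
    set e : ℝ → EuclideanSpace ℝ (Fin m) := fun s => F s y with he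
    have hyp : ∀ t ∈ Set.Icc 0 T, y t = pth r xhat e t := by
      intro t ht
      rcases le_total t r with h | h
      · rw [pth_of_le h, hyx t ⟨ht.1, h⟩]
      · rw [pth_of_ge h, hye t ⟨h, ht.2⟩, hyx r ⟨hr, le_rfl⟩]
    have hee : ∀ᵐ s ∂μ, e s = F s (pth r xhat e) := by
      rw [hμ, ae_restrict_iff' measurableSet_Icc]
      refine ae_of_all _ fun s hs => ?_
      exact hFna s hs _ _ fun u hu => hyp u ⟨hu.1, hu.2.trans hs.2⟩
    have heL : MemLp e 2 μ := (memLp_congr_ae hee).2 (hPhi e hyi)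
    obtain ⟨w, hw1, hw⟩ := contr (max (∫ s in Set.Icc r T, ‖e s‖ ^ 2)
      (∫ s in Set.Icc r T, ‖D s‖ ^ 2))
    set M := ∫ s in Set.Icc r T, ‖e s - D s‖ ^ 2 with hMdef
    have hM : 0 ≤ M := sq0 (fun s => e s - D s)
    have key : ∀ n : ℕ, ∀ t ∈ Set.Icc r T,
        ∫ s in Set.Icc r t, ‖e s - D s‖ ^ 2 ≤ M * (1 / 4) ^ n * w t := by
      intro n
      induction n with
      | zero =>
        intro t ht
        have h1 := mono_t (fun s => e s - D s) (heL.sub hDL) t ht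
        have h2 := mul_le_mul_of_nonneg_left (hw1 t ht) hM
        simp only [pow_zero, mul_one, zero_add]
        linarith
      | succ n ih =>
        intro t ht
        have h := hw e D e D heL hDL heL hDL hee hfix (le_max_left _ _) (le_max_right _ _)
          (M * (1 / 4) ^ n) (by positivity) ih t ht
        rwa [pow_succ, ← mul_assoc]
    have hM0 : M ≤ 0 := by
      have ht : Tendsto (fun n : ℕ => M * (1 / 4 : ℝ) ^ n * w T) atTop (nhds (M * 0 * w T)) :=
        ((tendsto_pow_atTop_nhds_zero_of_lt_one (by norm_num) (by norm_num)).const_mul M).mul_const _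
      have := ge_of_tendsto' ht (fun n => key n T hTmem)
      simpa using this
    have hae : e =ᵐ[μ] D := by
      rw [← MemLp.toLp_eq_toLp_iff heL hDL, ← dist_le_zero, l2_dist]
      rw [Real.sqrt_eq_zero_of_nonpos hM0]
    intro t ht
    rw [hyp t ht]
    exact pth_congr hae hrT.le ht.2
  · -- convergence
    intro dseq hds
    refine hlim.congr fun n => ?_
    unfold hNorm
    rw [supIcc_zero, zero_add]
    · congr 1
      apply integral_congr_ae
      have hae : d n =ᵐ[μ] dseq n := by
        refine ae_eq_of_primitive hrT.le (memLp_int (hdL n)) (hds n).2.1.1 fun t ht => ?_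
        have h1 := (hds n).2.1.2 t ht
        rw [hxd n, pth_of_ge ht.1, pth_of_le le_rfl] at h1
        exact add_left_cancel h1
      filter_upwards [hae] with s hs
      rw [hs]
    · intro s _
      beta_reduce
      rw [hxd n, pth_of_le (min_le_right _ _), pth_of_le (min_le_right _ _), sub_self]
end

section
/- Let F : [r,T] × C([0,T],ℝ^m) → ℝ^m be product measurable and non-anticipative and assume condition (C.1) holds. Then every mild solution x to ẋ(t) = F(t,x) on [r,T] satisfies ‖x^t‖_{H,r}² ≤ c_H · exp(c_H ∫_r^t c₀(s)² ds) · (‖x^r‖_∞² + ∫_r^t c₀(s)² ds) for all t ∈ [r,T], where c_H := 4·max{1, T−r}. In particular ‖x‖_{H,r} < ∞. -/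
open MeasureTheory Set Filter

lemma gron_aux (r t lam : ℝ) (hrt : r ≤ t) (hlam : 0 ≤ lam) (C Y : ℝ → ℝ)
    (hC : ContinuousOn C (Set.Icc r t)) (hCr : C r = 0) (hC0 : ∀ s ∈ Set.Icc r t, 0 ≤ C s)
    (hY0 : ∀ s ∈ Set.Icc r t, 0 ≤ Y s)
    (hY : ∀ s ∈ Set.Icc r t, ∀ s' ∈ Set.Icc r t, s ≤ s' →
      Y s' - Y s ≤ lam * (C s' - C s) * Y s') :
    Y t ≤ Y r * Real.exp (lam * C t) := by
  have hrm : r ∈ Set.Icc r t := ⟨le_rfl, hrt⟩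
  have htm : t ∈ Set.Icc r t := ⟨hrt, le_rfl⟩
  have key : ∀ n : ℕ, 0 < n → lam * C t ≤ n → Y t * (1 + -(lam * C t) / n) ^ n ≤ Y r := by
    intro n hn hle
    have hn' : (0 : ℝ) < n := by exact_mod_cast hn
    set d : ℝ := C t / n with hd
    have hd0 : 0 ≤ d := div_nonneg (hC0 t htm) hn'.le
    have hq : 1 + -(lam * C t) / n = 1 - lam * d := by rw [hd]; ring
    rw [hq]
    have hq0 : 0 ≤ 1 - lam * d := by
      have : lam * d = lam * C t / n := by rw [hd]; ring
      rw [this, sub_nonneg, div_le_one hn']; exact hle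
    have hq1 : 1 - lam * d ≤ 1 := by nlinarith [mul_nonneg hlam hd0]
    have ind : ∀ j : ℕ, ∀ s ∈ Set.Icc r t, C s ≤ j * d → Y s * (1 - lam * d) ^ j ≤ Y r := by
      intro j
      induction j with
      | zero =>
        intro s hs hCs
        have h1 := hY r hrm s hs hs.1
        have h2 : C s = 0 := le_antisymm (by simpa using hCs) (hC0 s hs)
        rw [h2, hCr] at h1
        simp at h1 ⊢
        exact h1
      | succ j ih =>
        intro s hs hCs
        by_cases h : C s ≤ j * d
        · have h1 := ih s hs h
          refine le_trans ?_ h1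
          have := hY0 s hs
          rw [pow_succ]
          have hp := pow_nonneg hq0 j
          exact mul_le_mul_of_nonneg_left (mul_le_of_le_one_right hp hq1) this
        · push Not at h
          have hsub : Set.Icc r s ⊆ Set.Icc r t := Set.Icc_subset_Icc_right hs.2
          have hivt := intermediate_value_Icc hs.1 (hC.mono hsub)
          have hm : (j : ℝ) * d ∈ Set.Icc (C r) (C s) := by
            rw [hCr]; exact ⟨by positivity, h.le⟩
          obtain ⟨u, hu, hCu⟩ := hivt hm
          have h1 := ih u (hsub hu) hCu.le
          have h2 := hY u (hsub hu) s hs hu.2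
          rw [hCu] at h2
          have h3 : C s - j * d ≤ d := by push_cast at hCs; linarith
          have h4 : lam * (C s - j * d) * Y s ≤ lam * d * Y s :=
            mul_le_mul_of_nonneg_right (mul_le_mul_of_nonneg_left h3 hlam) (hY0 s hs)
          have h5 : Y s * (1 - lam * d) ≤ Y u := by nlinarith
          calc Y s * (1 - lam * d) ^ (j + 1) = Y s * (1 - lam * d) * (1 - lam * d) ^ j := by ring
            _ ≤ Y u * (1 - lam * d) ^ j := mul_le_mul_of_nonneg_right h5 (pow_nonneg hq0 j)
            _ ≤ Y r := h1
    exact ind n t htm (by rw [hd]; field_simp; exact le_rfl)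
  have hlim := (Real.tendsto_one_add_div_pow_exp (-(lam * C t))).const_mul (Y t)
  have hle : Y t * Real.exp (-(lam * C t)) ≤ Y r := by
    refine le_of_tendsto hlim ?_
    obtain ⟨N, hN⟩ := exists_nat_ge (lam * C t)
    filter_upwards [Filter.eventually_ge_atTop (max N 1)] with n hn
    refine key n (lt_of_lt_of_le one_pos ((le_max_right _ _).trans hn)) (hN.trans ?_)
    exact_mod_cast (le_max_left _ _).trans hn
  rw [Real.exp_neg, ← div_eq_mul_inv, div_le_iff₀ (Real.exp_pos _)] at hle
  exact hle

lemma cs_aux (r t : ℝ) (hrt : r ≤ t) (g : ℝ → ℝ) (hg : IntegrableOn g (Set.Icc r t))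
    (hg2 : IntegrableOn (fun s => g s ^ 2) (Set.Icc r t)) :
    (∫ s in Set.Icc r t, g s) ^ 2 ≤ (t - r) * ∫ s in Set.Icc r t, g s ^ 2 := by
  rcases hrt.eq_or_lt with h | h
  · subst h; simp
  set I := ∫ s in Set.Icc r t, g s with hI
  set G := ∫ s in Set.Icc r t, g s ^ 2 with hG
  have h0 : 0 ≤ ∫ s in Set.Icc r t, ((t - r) * g s - I) ^ 2 :=
    integral_nonneg (fun s => sq_nonneg _)
  have hc : IntegrableOn (fun _ : ℝ => I ^ 2) (Set.Icc r t) := by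
    simp [integrableOn_const_iff]
  have h1 : ∫ s in Set.Icc r t, ((t - r) * g s - I) ^ 2
      = (t - r) ^ 2 * G - 2 * (t - r) * I * I + (t - r) * I ^ 2 := by
    have : (fun s => ((t - r) * g s - I) ^ 2)
        = fun s => (t - r) ^ 2 * g s ^ 2 - 2 * (t - r) * I * g s + I ^ 2 := by
      funext s; ring
    have hs : IntegrableOn (fun s => (t - r) ^ 2 * g s ^ 2 - 2 * (t - r) * I * g s)
        (Set.Icc r t) := (hg2.const_mul _).sub (hg.const_mul _)
    rw [this, integral_add hs hc,
      integral_sub (hg2.const_mul _) (hg.const_mul _), integral_const_mul, integral_const_mul]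
    simp [h.le, ← hI, ← hG]
  rw [h1] at h0
  have hpos : 0 < t - r := sub_pos.2 h
  have : 0 ≤ (t - r) * ((t - r) * G - I ^ 2) := by nlinarith
  have := nonneg_of_mul_nonneg_right this hpos
  linarith

lemma stop_aux {m : ℕ} (r T : ℝ) (hr : 0 ≤ r)
    (F : ℝ → (ℝ → EuclideanSpace ℝ (Fin m)) → EuclideanSpace ℝ (Fin m))
    (hFna : NonAnticipative r T F)
    (c₀ : ℝ → ℝ)
    (hC1 : ∀ t ∈ Set.Icc r T, ∀ x x' : ℝ → EuclideanSpace ℝ (Fin m),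
      ContinuousOn x (Set.Icc 0 T) → IsACDeriv r T x x' →
      ‖F t x‖ ≤ c₀ t * (1 + supIcc 0 T (fun s => x (min s r)) + ∫ s in Set.Icc r T, ‖x' s‖))
    (x : ℝ → EuclideanSpace ℝ (Fin m)) (hx : IsMildSol r T F x) (t : ℝ) (ht : t ∈ Set.Icc r T) :
    ‖F t x‖ ≤ c₀ t * (1 + supIcc 0 T (fun s => x (min s r)) + ∫ s in Set.Icc r t, ‖F s x‖) := by
  obtain ⟨hxc, hxi, hxe⟩ := hx
  have hy : F t x = F t (fun s => x (min s t)) := by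
    apply hFna t ht
    intro s hs
    simp only [min_eq_left hs.2]
  have h := hC1 t ht (fun s => x (min s t)) ((Set.Icc r t).indicator (fun s => F s x)) ?_ ?_
  · rw [hy]
    refine h.trans (le_of_eq ?_)
    have e1 : (fun s => x (min (min s r) t)) = fun s => x (min s r) := by
      funext s; rw [min_eq_left ((min_le_right s r).trans ht.1)]
    have e2 : ∫ s in Set.Icc r T, ‖(Set.Icc r t).indicator (fun s => F s x) s‖
        = ∫ s in Set.Icc r t, ‖F s x‖ := by
      simp_rw [norm_indicator_eq_indicator_norm]
      rw [setIntegral_indicator measurableSet_Icc, Set.Icc_inter_Icc]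
      simp [ht.2]
    simp only [e1, e2]
  · refine hxc.comp (by fun_prop) ?_
    intro s hs
    exact ⟨le_min hs.1 (hr.trans ht.1), (min_le_left _ _).trans hs.2⟩
  · refine ⟨hxi.indicator measurableSet_Icc, ?_⟩
    intro u hu
    have := hxe (min u t) ⟨le_min hu.1 ht.1, (min_le_left _ _).trans hu.2⟩
    rw [setIntegral_indicator measurableSet_Icc, Set.Icc_inter_Icc]
    simpa [min_eq_left ht.1] using this

lemma main_aux (r T a : ℝ) (hrT : r < T) (ha : 0 ≤ a) (g c₀ : ℝ → ℝ) (hg0 : ∀ s, 0 ≤ g s)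
    (hc0 : ∀ s, 0 ≤ c₀ s) (hg : IntegrableOn g (Set.Icc r T))
    (hc₀int : IntegrableOn (fun s => c₀ s ^ 2) (Set.Icc r T))
    (hb : ∀ t ∈ Set.Icc r T, g t ≤ c₀ t * (1 + a + ∫ s in Set.Icc r t, g s)) :
    IntegrableOn (fun s => g s ^ 2) (Set.Icc r T) ∧
    ∀ t ∈ Set.Icc r T,
      (a + Real.sqrt (∫ s in Set.Icc r t, g s ^ 2)) ^ 2
        ≤ (4 * max 1 (T - r)) *
            Real.exp ((4 * max 1 (T - r)) * ∫ s in Set.Icc r t, c₀ s ^ 2) *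
            (a ^ 2 + ∫ s in Set.Icc r t, c₀ s ^ 2) := by
  have hsubT : ∀ {t}, t ∈ Set.Icc r T → Set.Icc r t ⊆ Set.Icc r T :=
    fun ht => Set.Icc_subset_Icc_right ht.2
  have hg2 : IntegrableOn (fun s => g s ^ 2) (Set.Icc r T) := by
    set B := 1 + a + ∫ s in Set.Icc r T, g s with hB
    refine Integrable.mono' (hc₀int.const_mul (B ^ 2)) (hg.aestronglyMeasurable.pow 2) ?_
    refine (ae_restrict_iff' measurableSet_Icc).2 (Filter.Eventually.of_forall fun s hs => ?_)
    have h1 : ∫ u in Set.Icc r s, g u ≤ ∫ u in Set.Icc r T, g u :=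
      setIntegral_mono_set hg (Filter.Eventually.of_forall hg0) (hsubT hs).eventuallyLE
    have h2 : g s ≤ c₀ s * B :=
      (hb s hs).trans (mul_le_mul_of_nonneg_left (by linarith) (hc0 s))
    rw [Real.norm_eq_abs, abs_of_nonneg (sq_nonneg _)]
    calc g s ^ 2 ≤ (c₀ s * B) ^ 2 := pow_le_pow_left₀ (hg0 s) h2 2
      _ = B ^ 2 * c₀ s ^ 2 := by ring
  refine ⟨hg2, ?_⟩
  set K := max 1 (T - r) with hK
  have hK1 : 1 ≤ K := le_max_left _ _
  have hKT : T - r ≤ K := le_max_right _ _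
  set G : ℝ → ℝ := fun t => ∫ s in Set.Icc r t, g s ^ 2 with hG
  set C : ℝ → ℝ := fun t => ∫ s in Set.Icc r t, c₀ s ^ 2 with hC
  set N : ℝ → ℝ := fun t => (a + Real.sqrt (G t)) ^ 2 with hN
  have hGc : ContinuousOn G (Set.Icc r T) := intervalIntegral.continuousOn_primitive_Icc hg2
  have hCc : ContinuousOn C (Set.Icc r T) := intervalIntegral.continuousOn_primitive_Icc hc₀int
  have hNc : ContinuousOn N (Set.Icc r T) := (continuousOn_const.add hGc.sqrt).pow 2
  have hG0 : ∀ t, 0 ≤ G t := fun t => integral_nonneg fun s => sq_nonneg _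
  have hC0 : ∀ t, 0 ≤ C t := fun t => integral_nonneg fun s => sq_nonneg _
  have hN0 : ∀ t, 0 ≤ N t := fun t => sq_nonneg _
  have hcN : IntegrableOn (fun s => c₀ s ^ 2 * N s) (Set.Icc r T) :=
    hc₀int.mul_continuousOn hNc isCompact_Icc
  have hcN0 : ∀ s, 0 ≤ c₀ s ^ 2 * N s := fun s => mul_nonneg (sq_nonneg _) (hN0 s)
  set V : ℝ → ℝ := fun t => ∫ s in Set.Icc r t, c₀ s ^ 2 * N s with hV
  have hV0 : ∀ t, 0 ≤ V t := fun t => integral_nonneg hcN0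
  -- pointwise bound
  have hpt : ∀ s ∈ Set.Icc r T, g s ^ 2 ≤ 2 * c₀ s ^ 2 + 2 * K * (c₀ s ^ 2 * N s) := by
    intro s hs
    set I := ∫ u in Set.Icc r s, g u with hI
    have hI0 : 0 ≤ I := integral_nonneg hg0
    have hcs : I ^ 2 ≤ (s - r) * G s :=
      cs_aux r s hs.1 g (hg.mono_set (hsubT hs)) (hg2.mono_set (hsubT hs))
    have hIK : I ^ 2 ≤ K * G s :=
      hcs.trans (mul_le_mul_of_nonneg_right (by linarith [hs.2]) (hG0 s))
    have hIs : I ≤ Real.sqrt K * Real.sqrt (G s) := by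
      rw [← Real.sqrt_mul (by linarith)]
      exact Real.le_sqrt_of_sq_le hIK
    have hsK : 1 ≤ Real.sqrt K := Real.one_le_sqrt.2 hK1
    have haI : a + I ≤ Real.sqrt K * (a + Real.sqrt (G s)) := by nlinarith
    have haI2 : (a + I) ^ 2 ≤ K * N s := by
      calc (a + I) ^ 2 ≤ (Real.sqrt K * (a + Real.sqrt (G s))) ^ 2 :=
            pow_le_pow_left₀ (by positivity) haI 2
        _ = K * N s := by rw [mul_pow, Real.sq_sqrt (by linarith)]
    have h1 : (1 + a + I) ^ 2 ≤ 2 + 2 * K * N s := by nlinarith [sq_nonneg (1 - (a + I))]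
    calc g s ^ 2 ≤ (c₀ s * (1 + a + I)) ^ 2 := pow_le_pow_left₀ (hg0 s) (hb s hs) 2
      _ = c₀ s ^ 2 * (1 + a + I) ^ 2 := by ring
      _ ≤ c₀ s ^ 2 * (2 + 2 * K * N s) := mul_le_mul_of_nonneg_left h1 (sq_nonneg _)
      _ = _ := by ring
  have hGle : ∀ t ∈ Set.Icc r T, G t ≤ 2 * C t + 2 * K * V t := by
    intro t ht
    have i1 := (hc₀int.mono_set (hsubT ht)).const_mul 2
    have i2 := (hcN.mono_set (hsubT ht)).const_mul (2 * K)
    have := setIntegral_mono_on (hg2.mono_set (hsubT ht)) (i1.add i2) measurableSet_Icc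
      (fun s hs => hpt s (hsubT ht hs))
    refine this.trans (le_of_eq ?_)
    simp only [Pi.add_apply]
    rw [integral_add i1 i2, integral_const_mul, integral_const_mul]
  have hNle : ∀ t ∈ Set.Icc r T, N t ≤ 2 * a ^ 2 + 4 * C t + 4 * K * V t := by
    intro t ht
    have h1 : N t ≤ 2 * a ^ 2 + 2 * G t := by
      have := Real.sq_sqrt (hG0 t)
      simp only [hN]
      nlinarith [sq_nonneg (a - Real.sqrt (G t))]
    linarith [hGle t ht]
  have hmono : ∀ f : ℝ → ℝ, (∀ s, 0 ≤ f s) → IntegrableOn f (Set.Icc r T) →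
      ∀ s s', r ≤ s → s ≤ s' → s' ≤ T →
      ∫ u in Set.Icc r s', f u = (∫ u in Set.Icc r s, f u) + ∫ u in Set.Ioc s s', f u := by
    intro f _ hf s s' h1 h2 h3
    rw [← Set.Icc_union_Ioc_eq_Icc h1 h2]
    refine setIntegral_union ?_ measurableSet_Ioc (hf.mono_set ?_) (hf.mono_set ?_)
    · rw [Set.disjoint_left]
      intro u hu hu'
      exact absurd hu.2 (not_le.2 hu'.1)
    · exact Set.Icc_subset_Icc_right (h2.trans h3)
    · exact fun u hu => ⟨h1.trans hu.1.le, hu.2.trans h3⟩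
  intro t ht
  set A := 2 * a ^ 2 + 4 * C t with hA
  have hA0 : 0 ≤ A := by have := hC0 t; positivity
  have hCmono : ∀ s s', r ≤ s → s ≤ s' → s' ≤ T → C s ≤ C s' := by
    intro s s' h1 h2 h3
    have h := hmono _ (fun s => sq_nonneg (c₀ s)) hc₀int s s' h1 h2 h3
    have h' : 0 ≤ ∫ u in Set.Ioc s s', c₀ u ^ 2 := integral_nonneg fun s => sq_nonneg _
    simp only [hC]; linarith
  have hVmono : ∀ s s', r ≤ s → s ≤ s' → s' ≤ T → V s ≤ V s' := by
    intro s s' h1 h2 h3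
    have h := hmono _ hcN0 hcN s s' h1 h2 h3
    have h' : 0 ≤ ∫ u in Set.Ioc s s', c₀ u ^ 2 * N u := integral_nonneg hcN0
    simp only [hV]; linarith
  have hgr := gron_aux r t (4 * K) ht.1 (by linarith) C (fun s => A + 4 * K * V s)
    (hCc.mono (hsubT ht)) (by simp [hC]) (fun s _ => hC0 s)
    (fun s _ => by have := hV0 s; positivity) ?_
  · have hVr : V r = 0 := by simp [hV]
    simp only [hVr, mul_zero, add_zero] at hgr
    have h1 : N t ≤ A * Real.exp (4 * K * C t) := (hNle t ht).trans hgr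
    refine h1.trans ?_
    have h2 : A ≤ 4 * K * (a ^ 2 + C t) := by
      have := hC0 t
      have := sq_nonneg a
      nlinarith
    calc A * Real.exp (4 * K * C t) ≤ 4 * K * (a ^ 2 + C t) * Real.exp (4 * K * C t) :=
          mul_le_mul_of_nonneg_right h2 (Real.exp_pos _).le
      _ = _ := by ring
  · intro s hs s' hs' hss
    have hs'T := hs'.2.trans ht.2
    have e1 := hmono _ hcN0 hcN s s' hs.1 hss hs'T
    have e2 := hmono _ (fun s => sq_nonneg (c₀ s)) hc₀int s s' hs.1 hss hs'T
    have hsub : Set.Ioc s s' ⊆ Set.Icc r T :=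
      fun u hu => ⟨hs.1.trans hu.1.le, hu.2.trans hs'T⟩
    have h3 : ∫ u in Set.Ioc s s', c₀ u ^ 2 * N u
        ≤ ∫ u in Set.Ioc s s', c₀ u ^ 2 * (A + 4 * K * V s') := by
      refine setIntegral_mono_on (hcN.mono_set hsub) ((hc₀int.mono_set hsub).mul_const _)
        measurableSet_Ioc ?_
      intro u hu
      refine mul_le_mul_of_nonneg_left ?_ (sq_nonneg _)
      have hu' := hsub hu
      have h4 := hNle u hu'
      have h5 := hCmono u t hu'.1 (hu.2.trans hs'.2) ht.2
      have h6 := hVmono u s' hu'.1 hu.2 hs'T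
      have h7 : 4 * K * V u ≤ 4 * K * V s' := mul_le_mul_of_nonneg_left h6 (by linarith)
      linarith
    rw [integral_mul_const] at h3
    have e1' : V s' - V s = ∫ u in Set.Ioc s s', c₀ u ^ 2 * N u := by
      simp only [hV]; linarith
    have e2' : C s' - C s = ∫ u in Set.Ioc s s', c₀ u ^ 2 := by
      simp only [hC]; linarith
    rw [← e1', ← e2'] at h3
    have := mul_le_mul_of_nonneg_left h3 (by linarith : (0:ℝ) ≤ 4 * K)
    linarith

/-- **A priori bound for mild solutions** (Lemma 3.1 / Statement 2): under (C.1),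
every mild solution `x` of `ẋ(t) = F(t,x)` on `[r,T]` satisfies, for all `t ∈ [r,T]`,
`‖x^t‖_{H,r}² ≤ c_H e^{c_H ∫_r^t c₀²} (‖x^r‖_∞² + ∫_r^t c₀²)` with
`c_H = 4·max{1,T−r}`; in particular `‖x‖_{H,r} < ∞`.
Here the a.e. derivative of `x` on `[r,T]` is `s ↦ F(s,x)`. -/
theorem mild_solution_apriori_bound {m : ℕ} (r T : ℝ) (hr : 0 ≤ r) (hrT : r < T)
    (F : ℝ → (ℝ → EuclideanSpace ℝ (Fin m)) → EuclideanSpace ℝ (Fin m))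
    (hFmeas : ProdMeasurable F) (hFna : NonAnticipative r T F)
    (c₀ : ℝ → ℝ) (hc₀meas : Measurable c₀) (hc₀nonneg : ∀ s, 0 ≤ c₀ s)
    (hc₀int : IntegrableOn (fun s => c₀ s ^ 2) (Set.Icc r T))
    (hC1 : ∀ t ∈ Set.Icc r T, ∀ x x' : ℝ → EuclideanSpace ℝ (Fin m),
      ContinuousOn x (Set.Icc 0 T) → IsACDeriv r T x x' →
      ‖F t x‖ ≤ c₀ t * (1 + supIcc 0 T (fun s => x (min s r)) + ∫ s in Set.Icc r T, ‖x' s‖))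
    (x : ℝ → EuclideanSpace ℝ (Fin m)) (hx : IsMildSol r T F x) :
    IntegrableOn (fun s => ‖F s x‖ ^ 2) (Set.Icc r T) ∧
    ∀ t ∈ Set.Icc r T,
      (supIcc 0 T (fun s => x (min s r)) +
          Real.sqrt (∫ s in Set.Icc r t, ‖F s x‖ ^ 2)) ^ 2
        ≤ (4 * max 1 (T - r)) *
            Real.exp ((4 * max 1 (T - r)) * ∫ s in Set.Icc r t, c₀ s ^ 2) *
            ((supIcc 0 T (fun s => x (min s r))) ^ 2 + ∫ s in Set.Icc r t, c₀ s ^ 2) := by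
  have ha : 0 ≤ supIcc 0 T (fun s => x (min s r)) := by
    refine Real.sSup_nonneg ?_
    rintro _ ⟨u, _, rfl⟩
    exact norm_nonneg _
  exact main_aux r T _ hrT ha (fun s => ‖F s x‖) c₀ (fun s => norm_nonneg _) hc₀nonneg
    hx.2.1.norm hc₀int (fun t ht => stop_aux r T hr F hFna c₀ hC1 x hx t ht)
end

section
/- Let F : [r,T] × C([0,T],ℝ^m) → ℝ^m be product measurable and non-anticipative and assume conditions (C.1) and (C.2) hold. If x and x̃ are two mild solutions to ẋ(t) = F(t,x) on [r,T] satisfying x(s) = x̃(s) for all s ∈ [0,r], then x = x̃ on all of [0,T]. -/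
open MeasureTheory Set Filter

open scoped Topology

lemma gronwall_zero (r T : ℝ) (hrT : r < T) (g k : ℝ → ℝ)
    (hg : IntegrableOn g (Icc r T)) (hk : IntegrableOn k (Icc r T))
    (hg0 : ∀ t, 0 ≤ g t) (hk0 : ∀ t, 0 ≤ k t)
    (h : ∀ t ∈ Icc r T, g t ≤ k t * ∫ s in Icc r t, g s) :
    ∀ t ∈ Icc r T, ∫ s in Icc r t, g s = 0 := by
  have hcong : ∀ (f : ℝ → ℝ) (t : ℝ), r ≤ t → ∫ s in Icc r t, f s = ∫ s in r..t, f s := by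
    intro f t ht
    rw [intervalIntegral.integral_of_le ht, integral_Icc_eq_integral_Ioc]
  have hii : ∀ (f : ℝ → ℝ), IntegrableOn f (Icc r T) → ∀ a ∈ Icc r T, ∀ b ∈ Icc r T,
      IntervalIntegrable f volume a b := by
    intro f hf a ha b hb
    rw [intervalIntegrable_iff]
    refine hf.mono_set ?_
    intro s hs
    have := uIoc_subset_uIcc hs
    exact (uIcc_subset_Icc ha hb) this
  have hcont : ∀ (f : ℝ → ℝ), IntegrableOn f (Icc r T) →
      ContinuousOn (fun t => ∫ s in r..t, f s) (Icc r T) := by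
    intro f hf
    have := intervalIntegral.continuousOn_primitive_interval (a := r) (b := T) (f := f)
      (μ := volume) (by rwa [uIcc_of_le hrT.le])
    rwa [uIcc_of_le hrT.le] at this
  have hr : r ∈ Icc r T := ⟨le_rfl, hrT.le⟩
  have key : Icc r T ⊆ {t | ∫ s in r..t, g s = 0} := by
    apply IsClosed.Icc_subset_of_forall_exists_gt
    · have := (hcont g hg).preimage_isClosed_of_isClosed isClosed_Icc (isClosed_singleton (x := 0))
      rw [inter_comm]
      exact this
    · simp
    · rintro t ⟨ht0, ht⟩ y hy
      have htI : t ∈ Icc r T := ⟨ht.1, ht.2.le⟩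
      have ht0' : ∫ s in r..t, g s = 0 := ht0
      -- choose z with the integral of k from t to z at most 1/2
      have hc := (hcont k hk) t htI
      have h1 : ∀ᶠ z in 𝓝[Icc r T] t, ∫ s in r..z, k s < (∫ s in r..t, k s) + 1/2 :=
        hc.eventually (gt_mem_nhds (by linarith))
      have h2 : ∀ᶠ z in 𝓝[>] t, z ∈ Ioo t (min y T) :=
        Ioo_mem_nhdsGT (lt_min hy ht.2)
      have h3 : 𝓝[Ioo t T] t ≤ 𝓝[Icc r T] t :=
        nhdsWithin_mono _ (fun z hz => ⟨ht.1.trans hz.1.le, hz.2.le⟩)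
      rw [nhdsWithin_Ioo_eq_nhdsGT ht.2] at h3
      obtain ⟨z, hz1, hz2⟩ := ((h1.filter_mono h3).and h2).exists
      have hzT : z < T := hz2.2.trans_le (min_le_right _ _)
      have hzy : z < y := hz2.2.trans_le (min_le_left _ _)
      have hzI : z ∈ Icc r T := ⟨ht.1.trans hz2.1.le, hzT.le⟩
      refine ⟨z, ?_, hz2.1, hzy.le⟩
      show ∫ s in r..z, g s = 0
      have e1 := intervalIntegral.integral_add_adjacent_intervals
        (hii g hg r hr t htI) (hii g hg t htI z hzI)
      have e2 := intervalIntegral.integral_add_adjacent_intervals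
        (hii k hk r hr t htI) (hii k hk t htI z hzI)
      set M := ∫ s in r..z, g s with hM
      have hM0 : 0 ≤ M := intervalIntegral.integral_nonneg hzI.1 (fun u _ => hg0 u)
      have e3 : ∫ s in t..z, g s ≤ ∫ s in t..z, k s * M := by
        apply intervalIntegral.integral_mono_on hz2.1.le (hii g hg t htI z hzI)
          ((hii k hk t htI z hzI).mul_const M)
        intro s hs
        have hsI : s ∈ Icc r T := ⟨ht.1.trans hs.1, hs.2.trans hzT.le⟩
        refine (h s hsI).trans (mul_le_mul_of_nonneg_left ?_ (hk0 s))
        rw [hcong g s hsI.1]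
        have e4 := intervalIntegral.integral_add_adjacent_intervals
          (hii g hg r hr s hsI) (hii g hg s hsI z hzI)
        have : 0 ≤ ∫ u in s..z, g u := intervalIntegral.integral_nonneg hs.2 (fun u _ => hg0 u)
        linarith
      rw [intervalIntegral.integral_mul_const] at e3
      nlinarith
  intro t ht
  rw [hcong g t ht.1]
  exact key ht

section
variable {E : Type*} [NormedAddCommGroup E] [NormedSpace ℝ E] [CompleteSpace E]

lemma norm_indicator_sq (S : Set ℝ) (f : ℝ → E) :
    (fun s => ‖S.indicator f s‖ ^ 2) = S.indicator (fun s => ‖f s‖ ^ 2) := by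
  ext s
  by_cases hs : s ∈ S <;> simp [hs]

lemma MemH1.stopped {r T t : ℝ} (hr : 0 ≤ r) (ht : t ∈ Icc r T) {x x' : ℝ → E}
    (h : MemH1 r T x x') :
    MemH1 r T (fun s => x (min s t)) ((Icc r t).indicator x') := by
  obtain ⟨h1, ⟨h2, h3⟩, h4⟩ := h
  refine ⟨?_, ⟨?_, ?_⟩, ?_⟩
  · refine h1.comp (by fun_prop) ?_
    intro s hs
    exact ⟨le_min hs.1 (hr.trans ht.1), (min_le_left _ _).trans hs.2⟩
  · exact Integrable.indicator h2 measurableSet_Icc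
  · intro u hu
    simp only
    rw [h3 (min u t) ⟨le_min hu.1 ht.1, (min_le_left _ _).trans hu.2⟩, min_eq_left ht.1,
      setIntegral_indicator measurableSet_Icc, Icc_inter_Icc, sup_idem]
  · rw [norm_indicator_sq]
    exact Integrable.indicator h4 measurableSet_Icc

lemma hNorm_stopped_le {r T t : ℝ} (ht : t ∈ Icc r T) {x x' : ℝ → E}
    (h : MemH1 r T x x') :
    hNorm r T (fun s => x (min s t)) ((Icc r t).indicator x') ≤ hNorm r T x x' := by
  unfold hNorm
  have e : (fun s => x (min (min s r) t)) = fun s => x (min s r) := by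
    ext s
    rw [min_eq_left ((min_le_right s r).trans ht.1)]
  simp only [e]
  refine add_le_add le_rfl (Real.sqrt_le_sqrt ?_)
  rw [norm_indicator_sq]
  refine setIntegral_mono_on (Integrable.indicator h.2.2 measurableSet_Icc) h.2.2
    measurableSet_Icc ?_
  intro s _
  exact indicator_le_self' (fun _ _ => by positivity) s

lemma mild_memH1 {r T : ℝ} {F : ℝ → (ℝ → E) → E} (hC1 : CondC1 r T F) {x : ℝ → E}
    (hx : IsMildSol r T F x) : MemH1 r T x (fun s => F s x) := by
  obtain ⟨h1, h2, h3⟩ := hx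
  refine ⟨h1, ⟨h2, h3⟩, ?_⟩
  obtain ⟨c, hcm, hc0, hc2, hc⟩ := hC1
  have hb := fun t ht => hc t ht x (fun s => F s x) h1 ⟨h2, h3⟩
  set K := 1 + supIcc 0 T (fun s => x (min s r)) + ∫ s in Icc r T, ‖F s x‖
  refine Integrable.mono' (hc2.mul_const (K ^ 2)) (h2.aestronglyMeasurable.norm.pow 2) ?_
  filter_upwards [ae_restrict_mem measurableSet_Icc] with t ht
  rw [Real.norm_of_nonneg (by positivity), ← mul_pow]
  exact pow_le_pow_left₀ (norm_nonneg _) (hb t ht) 2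
end

/-- **Uniqueness of mild solutions** (Lemma 3.2 / Statement 3): under (C.1) and (C.2),
two mild solutions of `ẋ(t) = F(t,x)` on `[r,T]` that agree on `[0,r]` coincide
on all of `[0,T]`. -/
theorem mild_solution_unique {m : ℕ} (r T : ℝ) (hr : 0 ≤ r) (hrT : r < T)
    (F : ℝ → (ℝ → EuclideanSpace ℝ (Fin m)) → EuclideanSpace ℝ (Fin m))
    (hFmeas : ProdMeasurable F) (hFna : NonAnticipative r T F)
    (hC1 : CondC1 r T F) (hC2 : CondC2 r T F)
    (x y : ℝ → EuclideanSpace ℝ (Fin m))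
    (hx : IsMildSol r T F x) (hy : IsMildSol r T F y)
    (hinit : ∀ s ∈ Set.Icc (0:ℝ) r, x s = y s) :
    Set.EqOn x y (Set.Icc 0 T) := by
  have hX := mild_memH1 hC1 hx
  have hY := mild_memH1 hC1 hy
  obtain ⟨n, hn⟩ := exists_nat_ge
    (max (hNorm r T x (fun s => F s x)) (hNorm r T y (fun s => F s y)))
  obtain ⟨lam, hlm, hl0, hl2, hl⟩ := hC2 n
  have hb : ∀ t ∈ Icc r T, ‖F t x - F t y‖ ≤
      lam t * Real.sqrt (∫ s in Icc r t, ‖F s x - F s y‖ ^ 2) := by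
    intro t ht
    have h1 := hl t ht _ _ _ _ (hX.stopped hr ht) (hY.stopped hr ht)
      ((hNorm_stopped_le ht hX).trans ((le_max_left _ _).trans hn))
      ((hNorm_stopped_le ht hY).trans ((le_max_right _ _).trans hn))
    rw [hFna t ht (fun s => x (min s t)) x (fun s hs => by simp only [min_eq_left hs.2]),
      hFna t ht (fun s => y (min s t)) y (fun s hs => by simp only [min_eq_left hs.2])] at h1
    refine h1.trans (mul_le_mul_of_nonneg_left ?_ (hl0 t))
    unfold hNorm
    have hs : supIcc 0 T (fun s => x (min (min s r) t) - y (min (min s r) t)) ≤ 0 := by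
      unfold supIcc
      refine csSup_le ((nonempty_Icc.2 (hr.trans hrT.le)).image _) ?_
      rintro _ ⟨s, hs, rfl⟩
      simp only
      rw [min_eq_left ((min_le_right s r).trans ht.1),
        hinit (min s r) ⟨le_min hs.1 hr, min_le_right _ _⟩]
      simp
    have e : (fun s => ‖(Icc r t).indicator (fun s => F s x) s
        - (Icc r t).indicator (fun s => F s y) s‖ ^ 2)
        = (Icc r t).indicator (fun s => ‖F s x - F s y‖ ^ 2) := by
      ext s
      by_cases hs : s ∈ Icc r t
      · simp only [indicator_of_mem hs]
      · simp [indicator_of_notMem hs]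
    rw [e, setIntegral_indicator measurableSet_Icc, Icc_inter_Icc, sup_idem, inf_eq_right.2 ht.2]
    linarith
  have hgint : IntegrableOn (fun s => ‖F s x - F s y‖ ^ 2) (Icc r T) := by
    refine Integrable.mono' ((hX.2.2.add hY.2.2).const_mul 2)
      ((hx.2.1.aestronglyMeasurable.sub hy.2.1.aestronglyMeasurable).norm.pow 2) ?_
    filter_upwards with s
    rw [Real.norm_of_nonneg (by positivity)]
    simp only [Pi.add_apply]
    have h1 := norm_sub_le (F s x) (F s y)
    have h2 := norm_nonneg (F s x - F s y)
    nlinarith [sq_nonneg (‖F s x‖ - ‖F s y‖)]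
  have hG := gronwall_zero r T hrT (fun s => ‖F s x - F s y‖ ^ 2) (fun s => lam s ^ 2)
    hgint hl2 (fun _ => by positivity) (fun _ => by positivity) (by
      intro t ht
      have h0 : 0 ≤ ∫ s in Icc r t, ‖F s x - F s y‖ ^ 2 :=
        integral_nonneg (fun _ => by positivity)
      have := pow_le_pow_left₀ (norm_nonneg _) (hb t ht) 2
      rwa [mul_pow, Real.sq_sqrt h0] at this)
  have hF : ∀ t ∈ Icc r T, F t x = F t y := by
    intro t ht
    have h1 := hb t ht
    rw [hG t ht, Real.sqrt_zero, mul_zero] at h1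
    exact sub_eq_zero.1 (norm_le_zero_iff.1 h1)
  intro t ht
  rcases le_total t r with h | h
  · exact hinit t ⟨ht.1, h⟩
  · rw [hx.2.2 t ⟨h, ht.2⟩, hy.2.2 t ⟨h, ht.2⟩, hinit r ⟨hr, le_rfl⟩]
    congr 1
    exact setIntegral_congr_fun measurableSet_Icc (fun s hs => hF s ⟨hs.1, hs.2.trans ht.2⟩)
end

section
/- (Quantitative Kolmogorov–Chentsov estimate.) Let X : [0,T] × Ω → ℝ^m be a stochastic process with right-continuous sample paths on a probability space (Ω,𝔽,P), and suppose there are c₀ ≥ 0, p ≥ 1 and q > 0 such that E[|X_s − X_t|^p] ≤ c₀|s−t|^{1+q} for all s,t ∈ [r,T]. Then for each α ∈ [0, q/p), E[ sup_{s,t∈[r,T], s≠t} |X_s − X_t|^p / |s−t|^{αp} ] ≤ k_{α,p,q} · c₀ · (T−r)^{1+q−αp}, where k_{α,p,q} := 2^{p+q}(2^{q/p−α} − 1)^{−p}. In particular, if q ≤ p, then almost every sample path of X is α-Hölder continuous on [r,T] for every α ∈ [0, q/p). -/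
open MeasureTheory Set Filter ENNReal

lemma mink_fin {Ω : Type*} {mΩ : MeasurableSpace Ω} (P : Measure Ω) (p : ℝ) (hp : 1 ≤ p)
    (f : ℕ → Ω → ℝ≥0∞) (hf : ∀ k, Measurable (f k)) (n : ℕ) :
    (∫⁻ ω, (∑ k ∈ Finset.range n, f k ω) ^ p ∂P) ^ (1 / p) ≤
      ∑ k ∈ Finset.range n, (∫⁻ ω, (f k ω) ^ p ∂P) ^ (1 / p) := by
  have hp0 : 0 < p := by linarith
  induction n with
  | zero => simp [hp0]
  | succ n ih =>
    simp only [Finset.sum_range_succ]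
    have := ENNReal.lintegral_Lp_add_le (μ := P) (f := fun ω => ∑ k ∈ Finset.range n, f k ω)
      (g := f n) (Finset.measurable_fun_sum _ (fun k _ => hf k)).aemeasurable
      (hf n).aemeasurable hp
    exact this.trans (by gcongr)

lemma mink {Ω : Type*} {mΩ : MeasurableSpace Ω} (P : Measure Ω) (p : ℝ) (hp : 1 ≤ p)
    (f : ℕ → Ω → ℝ≥0∞) (hf : ∀ k, Measurable (f k)) :
    ∫⁻ ω, (∑' k, f k ω) ^ p ∂P ≤
      (∑' k, (∫⁻ ω, (f k ω) ^ p ∂P) ^ (1 / p)) ^ p := by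
  have hp0 : 0 < p := by linarith
  have h1 : ∀ ω, (∑' k, f k ω) ^ p
      = liminf (fun n => (∑ k ∈ Finset.range n, f k ω) ^ p) atTop := by
    intro ω
    have : Tendsto (fun n => (∑ k ∈ Finset.range n, f k ω) ^ p) atTop
        (nhds ((∑' k, f k ω) ^ p)) :=
      (ENNReal.continuous_rpow_const.tendsto _).comp (ENNReal.tendsto_nat_tsum _)
    exact this.liminf_eq.symm
  simp_rw [h1]
  refine (lintegral_liminf_le fun n =>
    (Finset.measurable_fun_sum _ (fun k _ => hf k)).pow_const p).trans ?_
  refine Filter.liminf_le_of_le (by isBoundedDefault) ?_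
  intro b hb
  obtain ⟨n, hn⟩ := hb.exists
  refine hn.trans ?_
  have := mink_fin P p hp f hf n
  rw [one_div, ENNReal.rpow_inv_le_iff hp0] at this
  refine this.trans ?_
  simp only [one_div]
  gcongr
  exact ENNReal.sum_le_tsum _

lemma chain {E : Type*} [PseudoEMetricSpace E] (x : ℝ → E) (r T : ℝ) (hrT : r < T)
    (hx : ∀ t ∈ Set.Ico r T, ContinuousWithinAt x (Set.Ici t) t)
    (K : ℕ → ℝ≥0∞)
    (hK : ∀ k i : ℕ, i < 2 ^ k → edist (x (r + (T - r) * ((i : ℝ) / 2 ^ k)))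
      (x (r + (T - r) * (((i + 1 : ℕ) : ℝ) / 2 ^ k))) ≤ K k)
    (s t : ℝ) (hs : s ∈ Set.Icc r T) (ht : t ∈ Set.Icc r T) (n : ℕ)
    (hst : |s - t| / (T - r) ≤ (1 / 2) ^ n) :
    edist (x s) (x t) ≤ 2 * ∑' m, K (n + m) := by
  have hL : 0 < T - r := by linarith
  have hK2 : ∀ k i j : ℕ, i ≤ 2 ^ k → j ≤ 2 ^ k → i ≤ j + 1 → j ≤ i + 1 →
      edist (x (r + (T - r) * ((i : ℝ) / 2 ^ k))) (x (r + (T - r) * ((j : ℝ) / 2 ^ k))) ≤ K k := by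
    intro k i j hi hj hij hji
    rcases lt_trichotomy i j with h | h | h
    · obtain rfl : j = i + 1 := by omega
      exact hK k i (by omega)
    · subst h; simp
    · obtain rfl : i = j + 1 := by omega
      rw [edist_comm]
      exact hK k j (by omega)
  let c : ℝ → ℕ → ℕ := fun s k => ⌈2 ^ k * ((s - r) / (T - r))⌉₊
  let y : ℝ → ℕ → ℝ := fun s k => r + (T - r) * ((c s k : ℝ) / 2 ^ k)
  have hu : ∀ s ∈ Set.Icc r T, 0 ≤ (s - r) / (T - r) ∧ (s - r) / (T - r) ≤ 1 := by
    intro s hs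
    refine ⟨div_nonneg (by linarith [hs.1]) hL.le, ?_⟩
    rw [div_le_one hL]; linarith [hs.2]
  have hc : ∀ s ∈ Set.Icc r T, ∀ k, c s k ≤ 2 ^ k := by
    intro s hs k
    apply Nat.ceil_le.2
    push_cast
    have := (hu s hs).2
    have h2 : (0 : ℝ) < 2 ^ k := by positivity
    nlinarith
  have key : ∀ s ∈ Set.Icc r T, edist (x (y s n)) (x s) ≤ ∑' m, K (n + m + 1) := by
    intro s hs
    have hstep : ∀ k, edist (x (y s k)) (x (y s (k + 1))) ≤ K (k + 1) := by
      intro k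
      have e : y s k = r + (T - r) * (((2 * c s k : ℕ) : ℝ) / 2 ^ (k + 1)) := by
        simp only [y]; push_cast; rw [pow_succ]; field_simp
      rw [e]
      have hc1 := hc s hs k
      have hA : c s (k + 1) ≤ 2 * c s k := by
        apply Nat.ceil_le.2
        have := Nat.le_ceil (2 ^ k * ((s - r) / (T - r)))
        push_cast
        rw [pow_succ]
        simp only [c]
        linarith
      have hB : 2 * c s k < c s (k + 1) + 2 := by
        have h1 := Nat.ceil_lt_add_one (a := 2 ^ k * ((s - r) / (T - r)))
          (mul_nonneg (by positivity) (hu s hs).1)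
        have h2 := Nat.le_ceil (2 ^ (k + 1) * ((s - r) / (T - r)))
        have : (2 * c s k : ℝ) < c s (k + 1) + 2 := by
          simp only [c]
          rw [pow_succ] at h2 ⊢
          linarith
        exact_mod_cast this
      exact hK2 (k + 1) _ _ (by rw [pow_succ]; omega) (hc s hs _) (by omega) (by omega)
    have hys : ∀ k, s ≤ y s k ∧ y s k ≤ s + (T - r) * (1 / 2) ^ k := by
      intro k
      have h1 := Nat.ceil_lt_add_one (a := 2 ^ k * ((s - r) / (T - r)))
          (mul_nonneg (by positivity) (hu s hs).1)
      have h2 := Nat.le_ceil (2 ^ k * ((s - r) / (T - r)))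
      have h3 : (0 : ℝ) < 2 ^ k := by positivity
      have e : s = r + (T - r) * ((2 ^ k * ((s - r) / (T - r))) / 2 ^ k) := by
        field_simp; ring
      constructor
      · conv_lhs => rw [e]
        simp only [y, c]
        gcongr
      · have : s + (T - r) * (1 / 2) ^ k
          = r + (T - r) * ((2 ^ k * ((s - r) / (T - r)) + 1) / 2 ^ k) := by
          rw [one_div, inv_pow]
          field_simp; ring
        rw [this]
        simp only [y, c]
        gcongr
    have hlim : Tendsto (y s) atTop (nhds s) := by
      refine tendsto_of_tendsto_of_tendsto_of_le_of_le tendsto_const_nhds ?_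
        (fun k => (hys k).1) (fun k => (hys k).2)
      have := (tendsto_pow_atTop_nhds_zero_of_lt_one (r := (1 / 2 : ℝ)) (by norm_num)
        (by norm_num)).const_mul (T - r)
      simpa using this.const_add s
    have hlimx : Tendsto (fun k => x (y s k)) atTop (nhds (x s)) := by
      rcases hs.2.lt_or_eq with h | h
      · refine (hx s ⟨hs.1, h⟩).tendsto.comp ?_
        exact tendsto_nhdsWithin_iff.2 ⟨hlim, Eventually.of_forall fun k => (hys k).1⟩
      · have : ∀ k, y s k = s := by
          intro k
          simp only [y, c, h, div_self hL.ne', mul_one]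
          rw [show ((2 : ℝ) ^ k) = ((2 ^ k : ℕ) : ℝ) by push_cast; rfl, Nat.ceil_natCast,
            div_self (by positivity)]
          ring
        simp only [this]
        exact tendsto_const_nhds
    exact edist_le_tsum_of_edist_le_of_tendsto (fun k => K (k + 1)) hstep hlimx n
  have hmid : edist (x (y s n)) (x (y t n)) ≤ K n := by
    have h2 : (0 : ℝ) < 2 ^ n := by positivity
    have gen : ∀ s ∈ Set.Icc r T, ∀ t ∈ Set.Icc r T, |s - t| / (T - r) ≤ (1 / 2) ^ n →
        c s n ≤ c t n + 1 := by
      intro s hs t ht hst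
      apply Nat.ceil_le.2
      have h1 := Nat.le_ceil (2 ^ n * ((t - r) / (T - r)))
      have h3 : 2 ^ n * ((s - r) / (T - r)) - 2 ^ n * ((t - r) / (T - r)) ≤ 1 := by
        have : (s - t) / (T - r) ≤ (1 / 2) ^ n :=
          (div_le_div_of_nonneg_right (le_abs_self _) hL.le).trans hst
        calc _ = 2 ^ n * ((s - t) / (T - r)) := by ring
          _ ≤ 2 ^ n * (1 / 2) ^ n := by gcongr
          _ = 1 := by rw [← mul_pow]; norm_num
      push_cast
      simp only [c]
      linarith
    exact hK2 n _ _ (hc s hs n) (hc t ht n) (gen s hs t ht hst)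
      (gen t ht s hs (by rwa [abs_sub_comm]))
  have hsplit : ∑' m, K (n + m) = K n + ∑' m, K (n + m + 1) := by
    rw [tsum_eq_zero_add' ENNReal.summable]
    simp [add_assoc]
  calc edist (x s) (x t) ≤ edist (x s) (x (y s n)) + edist (x (y s n)) (x (y t n))
        + edist (x (y t n)) (x t) := edist_triangle4 _ _ _ _
    _ ≤ (∑' m, K (n + m + 1)) + K n + ∑' m, K (n + m + 1) := by
        gcongr
        · rw [edist_comm]; exact key s hs
        · exact key t ht
    _ ≤ (∑' m, K (n + m + 1)) + K n + ∑' m, K (n + m + 1) + K n := le_self_add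
    _ = 2 * ∑' m, K (n + m) := by rw [hsplit]; ring

lemma const_eq (c₀ p q α L : ℝ) (hp : 1 ≤ p) (hL : 0 < L) (hα : α < q / p) :
    (2 * 2 ^ α * L ^ (-α)) ^ p * (c₀ * L ^ (1 + q) * ((1 - (2 : ℝ) ^ (α - q / p))⁻¹) ^ p) =
      (((2 : ℝ) ^ (p + q) * ((2 : ℝ) ^ (q / p - α) - 1) ^ (-p)) * c₀ * L ^ (1 + q - α * p)) := by
  have hp0 : 0 < p := by linarith
  have hθ : 1 < (2 : ℝ) ^ (q / p - α) := Real.one_lt_rpow (by norm_num) (by linarith)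
  have hρ : (2 : ℝ) ^ (α - q / p) = ((2 : ℝ) ^ (q / p - α))⁻¹ := by
    rw [← Real.rpow_neg (by norm_num)]; congr 1; ring
  have e1 : (1 - (2 : ℝ) ^ (α - q / p))⁻¹ =
      (2 : ℝ) ^ (q / p - α) * ((2 : ℝ) ^ (q / p - α) - 1)⁻¹ := by
    rw [hρ]
    have : (2 : ℝ) ^ (q / p - α) - 1 ≠ 0 := by linarith
    have h0 : (2 : ℝ) ^ (q / p - α) ≠ 0 := by positivity
    field_simp
  have h1 : 0 < (2 : ℝ) ^ (q / p - α) - 1 := by linarith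
  rw [e1, Real.mul_rpow (by positivity) (by positivity), Real.mul_rpow (by positivity) (by positivity),
    Real.mul_rpow (by positivity) (by positivity), Real.inv_rpow h1.le, Real.rpow_neg h1.le,
    ← Real.rpow_mul (by norm_num), ← Real.rpow_mul hL.le, ← Real.rpow_mul (by norm_num)]
  have e2 : (2 : ℝ) ^ (p + q) = 2 ^ p * 2 ^ (α * p) * 2 ^ ((q / p - α) * p) := by
    rw [← Real.rpow_add (by norm_num), ← Real.rpow_add (by norm_num)]
    congr 1; field_simp; ring
  have e3 : L ^ (1 + q - α * p) = L ^ (-α * p) * L ^ (1 + q) := by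
    rw [← Real.rpow_add hL]; congr 1; ring
  rw [e2, e3]; ring

lemma core {m : ℕ} {Ω : Type*} {mΩ : MeasurableSpace Ω}
    (P : Measure Ω)
    (r T : ℝ) (hrT : r < T)
    (X : ℝ → Ω → EuclideanSpace ℝ (Fin m))
    (hXmeas : ∀ t, Measurable (X t))
    (hXrc : ∀ ω : Ω, ∀ t ∈ Set.Ico r T,
      ContinuousWithinAt (fun s => X s ω) (Set.Ici t) t)
    (c₀ p q : ℝ) (hc₀ : 0 ≤ c₀) (hp : 1 ≤ p)
    (hmom : ∀ s ∈ Set.Icc r T, ∀ t ∈ Set.Icc r T,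
      ∫⁻ ω, (‖X s ω - X t ω‖₊ : ℝ≥0∞) ^ p ∂P ≤
        ENNReal.ofReal (c₀ * |s - t| ^ (1 + q)))
    (α : ℝ) (hα0 : 0 ≤ α) (hα : α < q / p) :
    ∃ Z : Ω → ℝ≥0∞, Measurable Z ∧
      (∀ ω, ∀ s ∈ Set.Icc r T, ∀ t ∈ Set.Icc r T, s ≠ t →
        ENNReal.ofReal (‖X s ω - X t ω‖ ^ p / |s - t| ^ (α * p)) ≤ Z ω) ∧
      ∫⁻ ω, Z ω ∂P ≤ ENNReal.ofReal
            (((2 : ℝ) ^ (p + q) * ((2 : ℝ) ^ (q / p - α) - 1) ^ (-p)) * c₀ *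
              (T - r) ^ (1 + q - α * p)) := by
  have hp0 : 0 < p := by linarith
  have hL : 0 < T - r := by linarith
  let g : ℕ → ℕ → ℝ := fun k i => r + (T - r) * ((i : ℝ) / 2 ^ k)
  have hg : ∀ k i : ℕ, i ≤ 2 ^ k → g k i ∈ Set.Icc r T := by
    intro k i hi
    have h2 : (0 : ℝ) < 2 ^ k := by positivity
    have h3 : (i : ℝ) / 2 ^ k ≤ 1 := by
      rw [div_le_one h2]; exact_mod_cast hi
    have h4 : 0 ≤ (i : ℝ) / 2 ^ k := by positivity
    constructor <;> simp only [g] <;> nlinarith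
  let K : ℕ → Ω → ℝ≥0∞ := fun k ω =>
    (∑ i ∈ Finset.range (2 ^ k), (‖X (g k i) ω - X (g k (i + 1)) ω‖₊ : ℝ≥0∞) ^ p) ^ (1 / p)
  have hterm : ∀ k i, Measurable
      (fun ω => (‖X (g k i) ω - X (g k (i + 1)) ω‖₊ : ℝ≥0∞) ^ p) := by
    intro k i
    exact (((hXmeas _).sub (hXmeas _)).nnnorm.coe_nnreal_ennreal).pow_const p
  have hKm : ∀ k, Measurable (K k) := by
    intro k
    exact (Finset.measurable_fun_sum _ (fun i _ => hterm k i)).pow_const _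
  have hKint : ∀ k, (∫⁻ ω, (K k ω) ^ p ∂P) ≤
      ENNReal.ofReal (c₀ * (T - r) ^ (1 + q) * ((2 : ℝ) ^ (-q)) ^ k) := by
    intro k
    have : ∀ ω, (K k ω) ^ p =
        ∑ i ∈ Finset.range (2 ^ k), (‖X (g k i) ω - X (g k (i + 1)) ω‖₊ : ℝ≥0∞) ^ p := by
      intro ω
      simp only [K]
      rw [← ENNReal.rpow_mul, one_div, inv_mul_cancel₀ hp0.ne', ENNReal.rpow_one]
    simp_rw [this]
    rw [lintegral_finsetSum _ (fun i _ => hterm k i)]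
    have hb : ∀ i ∈ Finset.range (2 ^ k),
        ∫⁻ ω, (‖X (g k i) ω - X (g k (i + 1)) ω‖₊ : ℝ≥0∞) ^ p ∂P ≤
        ENNReal.ofReal (c₀ * ((T - r) / 2 ^ k) ^ (1 + q)) := by
      intro i hi
      have hi := Finset.mem_range.1 hi
      refine (hmom _ (hg k i hi.le) _ (hg k (i + 1) hi)).trans (le_of_eq ?_)
      have : |g k i - g k (i + 1)| = (T - r) / 2 ^ k := by
        have : g k i - g k (i + 1) = - ((T - r) / 2 ^ k) := by
          simp only [g]; push_cast; field_simp; ring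
        rw [this, abs_neg, abs_of_pos (by positivity)]
      rw [this]
    refine (Finset.sum_le_sum hb).trans (le_of_eq ?_)
    rw [Finset.sum_const, Finset.card_range, nsmul_eq_mul,
      show ((2 ^ k : ℕ) : ℝ≥0∞) = ENNReal.ofReal ((2 ^ k : ℕ) : ℝ) by rw [ENNReal.ofReal_natCast],
      ← ENNReal.ofReal_mul (by positivity)]
    congr 1
    have h2 : (0 : ℝ) < 2 ^ k := by positivity
    rw [Real.div_rpow hL.le h2.le, Real.rpow_add h2, Real.rpow_one, ← Real.rpow_natCast (2 ^ (-q)),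
      ← Real.rpow_mul (by norm_num), ← Real.rpow_natCast 2, ← Real.rpow_mul (by norm_num),
      show -q * (k : ℝ) = -(k * q) by ring, Real.rpow_neg (by norm_num)]
    push_cast
    rw [← Real.rpow_natCast 2]
    field_simp
  let S : Ω → ℝ≥0∞ := fun ω => ∑' k, ENNReal.ofReal (((2 : ℝ) ^ α) ^ k) * K k ω
  have hSm : Measurable S := Measurable.ennreal_tsum fun k => (hKm k).const_mul _
  have hbound : ∀ ω, ∀ s ∈ Set.Icc r T, ∀ t ∈ Set.Icc r T, s ≠ t →
      ENNReal.ofReal (‖X s ω - X t ω‖ / |s - t| ^ α) ≤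
        ENNReal.ofReal (2 * 2 ^ α * (T - r) ^ (-α)) * S ω := by
    intro ω s hs t ht hst
    have hd : 0 < |s - t| := abs_pos.2 (sub_ne_zero.2 hst)
    have hd1 : |s - t| / (T - r) ≤ 1 := by
      rw [div_le_one hL, abs_le]
      constructor <;> linarith [hs.1, hs.2, ht.1, ht.2]
    obtain ⟨n, hn1, hn2⟩ := exists_nat_pow_near_of_lt_one (div_pos hd hL) hd1
      (show (0 : ℝ) < 1 / 2 by norm_num) (by norm_num)
    have hch := chain (fun s => X s ω) r T hrT (hXrc ω) (fun k => K k ω) (by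
      intro k i hi
      have h1 : (‖X (g k i) ω - X (g k (i + 1)) ω‖₊ : ℝ≥0∞) ^ p ≤ _ :=
        Finset.single_le_sum
        (f := fun i => (‖X (g k i) ω - X (g k (i + 1)) ω‖₊ : ℝ≥0∞) ^ p)
        (fun _ _ => zero_le) (Finset.mem_range.2 hi)
      have h2 := ENNReal.rpow_le_rpow h1 (show 0 ≤ 1 / p by positivity)
      rw [← ENNReal.rpow_mul, mul_one_div_cancel hp0.ne', ENNReal.rpow_one] at h2
      rw [edist_eq_enorm_sub]
      exact h2) s t hs ht n hn2
    have hpow : (|s - t| ^ α)⁻¹ ≤ 2 ^ α * (T - r) ^ (-α) * ((2 : ℝ) ^ α) ^ n := by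
      rw [lt_div_iff₀ hL] at hn1
      have h1 : ((1 / 2) ^ (n + 1) * (T - r)) ^ α ≤ |s - t| ^ α :=
        Real.rpow_le_rpow (by positivity) hn1.le hα0
      refine (inv_anti₀ (by positivity) h1).trans (le_of_eq ?_)
      rw [Real.mul_rpow (by positivity) hL.le, Real.rpow_neg hL.le, mul_inv, one_div, inv_pow,
        Real.inv_rpow (by positivity), inv_inv, ← Real.rpow_natCast, ← Real.rpow_natCast,
        ← Real.rpow_mul (by norm_num), ← Real.rpow_mul (by norm_num), mul_right_comm,
        ← Real.rpow_add (by norm_num)]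
      congr 2
      push_cast; ring
    have hsum : ENNReal.ofReal (((2 : ℝ) ^ α) ^ n) * ∑' j, K (n + j) ω ≤ S ω := by
      rw [← ENNReal.tsum_mul_left]
      calc _ ≤ ∑' j, ENNReal.ofReal (((2 : ℝ) ^ α) ^ (n + j)) * K (n + j) ω := by
            refine ENNReal.tsum_le_tsum fun j => ?_
            gcongr
            · exact Real.one_le_rpow (by norm_num) hα0
            · omega
        _ ≤ S ω := ENNReal.tsum_comp_le_tsum_of_injective (add_right_injective n)
            (fun k => ENNReal.ofReal (((2 : ℝ) ^ α) ^ k) * K k ω)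
    calc ENNReal.ofReal (‖X s ω - X t ω‖ / |s - t| ^ α)
        = edist (X s ω) (X t ω) * ENNReal.ofReal ((|s - t| ^ α)⁻¹) := by
          rw [div_eq_mul_inv, ENNReal.ofReal_mul (norm_nonneg _), edist_eq_enorm_sub,
            ofReal_norm]
      _ ≤ (2 * ∑' j, K (n + j) ω) *
          ENNReal.ofReal (2 ^ α * (T - r) ^ (-α) * ((2 : ℝ) ^ α) ^ n) := by
          gcongr
      _ = ENNReal.ofReal (2 * 2 ^ α * (T - r) ^ (-α)) *
          (ENNReal.ofReal (((2 : ℝ) ^ α) ^ n) * ∑' j, K (n + j) ω) := by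
          rw [ENNReal.ofReal_mul (by positivity), mul_assoc (2 : ℝ), ENNReal.ofReal_mul (p := 2) (by norm_num),
            ENNReal.ofReal_ofNat]
          ring
      _ ≤ _ := by gcongr
  refine ⟨fun ω => ENNReal.ofReal ((2 * 2 ^ α * (T - r) ^ (-α)) ^ p) * S ω ^ p,
    (hSm.pow_const p).const_mul _, ?_, ?_⟩
  · intro ω s hs t ht hst
    have h := ENNReal.rpow_le_rpow (hbound ω s hs t ht hst) hp0.le
    rw [ENNReal.mul_rpow_of_nonneg _ _ hp0.le, ENNReal.ofReal_rpow_of_nonneg (by positivity) hp0.le,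
      ENNReal.ofReal_rpow_of_nonneg (by positivity) hp0.le,
      Real.div_rpow (by positivity) (by positivity), ← Real.rpow_mul (abs_nonneg _)] at h
    exact h
  · rw [lintegral_const_mul _ (hSm.pow_const p), ← const_eq c₀ p q α (T - r) hp hL hα,
      ENNReal.ofReal_mul (by positivity)]
    gcongr
    refine (mink P p hp (fun k ω => ENNReal.ofReal (((2 : ℝ) ^ α) ^ k) * K k ω)
      (fun k => (hKm k).const_mul _)).trans ?_
    have hρ1 : (2 : ℝ) ^ (α - q / p) < 1 :=
      Real.rpow_lt_one_of_one_lt_of_neg (by norm_num) (by linarith)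
    have hρ0 : 0 < (2 : ℝ) ^ (α - q / p) := by positivity
    have hk : ∀ k, (∫⁻ ω, (ENNReal.ofReal (((2 : ℝ) ^ α) ^ k) * K k ω) ^ p ∂P) ^ (1 / p) ≤
        ENNReal.ofReal ((c₀ * (T - r) ^ (1 + q)) ^ (1 / p) * ((2 : ℝ) ^ (α - q / p)) ^ k) := by
      intro k
      simp_rw [ENNReal.mul_rpow_of_nonneg _ _ hp0.le]
      rw [lintegral_const_mul _ ((hKm k).pow_const p),
        ENNReal.mul_rpow_of_nonneg _ _ (by positivity), ← ENNReal.rpow_mul,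
        mul_one_div_cancel hp0.ne', ENNReal.rpow_one]
      refine (mul_le_mul_right (ENNReal.rpow_le_rpow (hKint k)
        (show 0 ≤ 1 / p by positivity)) _).trans (le_of_eq ?_)
      rw [ENNReal.ofReal_rpow_of_nonneg (by positivity) (by positivity),
        ← ENNReal.ofReal_mul (by positivity)]
      congr 1
      rw [Real.mul_rpow (by positivity) (by positivity), mul_left_comm]
      congr 1
      simp only [← Real.rpow_natCast]
      rw [← Real.rpow_mul (by positivity), ← Real.rpow_mul (by positivity),
        ← Real.rpow_mul (by positivity), ← Real.rpow_mul (by positivity),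
        ← Real.rpow_add (by positivity)]
      congr 1
      ring
    calc _ ≤ (∑' k, ENNReal.ofReal
          ((c₀ * (T - r) ^ (1 + q)) ^ (1 / p) * ((2 : ℝ) ^ (α - q / p)) ^ k)) ^ p := by
          exact ENNReal.rpow_le_rpow (ENNReal.tsum_le_tsum hk) hp0.le
      _ = _ := by
          rw [← ENNReal.ofReal_tsum_of_nonneg (fun k => by positivity)
            ((summable_geometric_of_lt_one hρ0.le hρ1).mul_left _), tsum_mul_left,
            tsum_geometric_of_lt_one hρ0.le hρ1]
          have h1 : 0 < 1 - (2 : ℝ) ^ (α - q / p) := by linarith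
          rw [ENNReal.ofReal_rpow_of_nonneg (by positivity) hp0.le,
            Real.mul_rpow (by positivity) (by positivity), ← Real.rpow_mul (by positivity),
            one_div_mul_cancel hp0.ne', Real.rpow_one]

/-- **Quantitative Kolmogorov–Chentsov estimate** (Proposition 3.1 / Statement 4):
if a right-continuous process `X` satisfies `E[|X_s − X_t|^p] ≤ c₀|s−t|^{1+q}` on `[r,T]`,
then for every `α ∈ [0,q/p)`,
`E[sup_{s≠t} |X_s−X_t|^p/|s−t|^{αp}] ≤ k_{α,p,q} c₀ (T−r)^{1+q−αp}` with
`k_{α,p,q} = 2^{p+q}(2^{q/p−α}−1)^{−p}`; and if moreover `q ≤ p`, almost every sample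
path is `α`-Hölder continuous on `[r,T]` for all `α ∈ [0,q/p)`. -/
theorem kolmogorov_chentsov_estimate {m : ℕ} {Ω : Type*} {mΩ : MeasurableSpace Ω}
    (P : Measure Ω) [IsProbabilityMeasure P]
    (r T : ℝ) (hr : 0 ≤ r) (hrT : r < T)
    (X : ℝ → Ω → EuclideanSpace ℝ (Fin m))
    (hXmeas : ∀ t, Measurable (X t))
    (hXrc : ∀ ω : Ω, ∀ t ∈ Set.Ico r T,
      ContinuousWithinAt (fun s => X s ω) (Set.Ici t) t)
    (c₀ p q : ℝ) (hc₀ : 0 ≤ c₀) (hp : 1 ≤ p) (hq : 0 < q)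
    (hmom : ∀ s ∈ Set.Icc r T, ∀ t ∈ Set.Icc r T,
      ∫⁻ ω, (‖X s ω - X t ω‖₊ : ℝ≥0∞) ^ p ∂P ≤
        ENNReal.ofReal (c₀ * |s - t| ^ (1 + q))) :
    (∀ α : ℝ, 0 ≤ α → α < q / p →
      ∫⁻ ω, (⨆ (s : Set.Icc r T) (t : Set.Icc r T) (_ : (s : ℝ) ≠ (t : ℝ)),
          ENNReal.ofReal (‖X (s : ℝ) ω - X (t : ℝ) ω‖ ^ p / |(s : ℝ) - (t : ℝ)| ^ (α * p))) ∂P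
        ≤ ENNReal.ofReal
            (((2 : ℝ) ^ (p + q) * ((2 : ℝ) ^ (q / p - α) - 1) ^ (-p)) * c₀ *
              (T - r) ^ (1 + q - α * p))) ∧
    (q ≤ p → ∀ α : ℝ, 0 ≤ α → α < q / p → ∀ᵐ ω ∂P,
      ∃ C : ℝ, ∀ s ∈ Set.Icc r T, ∀ t ∈ Set.Icc r T,
        ‖X s ω - X t ω‖ ≤ C * |s - t| ^ α) := by
  refine ⟨?_, ?_⟩
  · intro α hα0 hα
    obtain ⟨Z, -, hZ, hZint⟩ := core P r T hrT X hXmeas hXrc c₀ p q hc₀ hp hmom α hα0 hα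
    refine (lintegral_mono fun ω => ?_).trans hZint
    exact iSup_le fun s => iSup_le fun t => iSup_le fun hst => hZ ω s s.2 t t.2 hst
  · intro _ α hα0 hα
    have hp0 : 0 < p := by linarith
    obtain ⟨Z, hZm, hZ, hZint⟩ := core P r T hrT X hXmeas hXrc c₀ p q hc₀ hp hmom α hα0 hα
    filter_upwards [ae_lt_top hZm (hZint.trans_lt ENNReal.ofReal_lt_top).ne] with ω hω
    refine ⟨(Z ω).toReal ^ (1 / p), fun s hs t ht => ?_⟩
    by_cases hst : s = t
    · subst hst
      simp only [sub_self, norm_zero]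
      positivity
    have hd : 0 < |s - t| := abs_pos.2 (sub_ne_zero.2 hst)
    have h := (ENNReal.ofReal_le_iff_le_toReal hω.ne).1 (hZ ω s hs t ht hst)
    rw [div_le_iff₀ (by positivity)] at h
    have h2 := Real.rpow_le_rpow (by positivity) h (show 0 ≤ 1 / p by positivity)
    rw [Real.mul_rpow ENNReal.toReal_nonneg (by positivity), ← Real.rpow_mul (norm_nonneg _),
      ← Real.rpow_mul hd.le, mul_assoc α, mul_one_div_cancel hp0.ne', Real.rpow_one, mul_one] at h2
    exact h2
end

section
/- Let (𝕋_n)_{n∈ℕ} be a balanced sequence of partitions of [r,T] with mesh tending to zero, and let (ₙX)_{n∈ℕ} be a sequence of ℝ^m-valued right-continuous processes for which there are p,q > 0 with q ≤ p such that for each β ∈ (0, q/p) there is c_β ≥ 0 satisfying P( max_{j∈{0,…,k_n−1}} sup_{s,t∈[t_{j,n},t_{j+1,n}], s≠t} |ₙX_s − ₙX_t|/|s−t|^β ≥ λ ) ≤ c_β λ^{−p} for all n ∈ ℕ and λ > 0. If both (sup_{t∈[0,T]}|ₙX_{r∧t}|)_{n∈ℕ} and (max_{j∈{1,…,k_n}}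 |ₙX_{t_{j,n}}| / |𝕋_n|^α)_{n∈ℕ} converge to zero in probability, then (‖ₙX‖_{α,r})_{n∈ℕ} converges to zero in probability, for any α ∈ [0, q/p). -/
open MeasureTheory Set Filter ENNReal

noncomputable section

variable {E : Type*} [NormedAddCommGroup E]

/-- Supremum (in `[0,∞]`) of `‖x‖` over the interval `[a,b]`. -/
def eSupIcc (a b : ℝ) (x : ℝ → E) : ℝ≥0∞ :=
  ⨆ t : Set.Icc a b, (‖x (t : ℝ)‖₊ : ℝ≥0∞)

/-- The `α`-Hölder seminorm (in `[0,∞]`) of `x` over `[a,b]`. -/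
def eHolderSem (a b α : ℝ) (x : ℝ → E) : ℝ≥0∞ :=
  ⨆ (s : Set.Icc a b) (t : Set.Icc a b) (_ : (s : ℝ) ≠ (t : ℝ)),
    ENNReal.ofReal (‖x (s : ℝ) - x (t : ℝ)‖ / |(s : ℝ) - (t : ℝ)| ^ α)

/-- The delayed `α`-Hölder norm (in `[0,∞]`):
`‖x‖_{α,r} = ‖x^r‖_∞ + sup_{s≠t ∈ [r,T]} ‖x(s)−x(t)‖/|s−t|^α` for `α ∈ (0,1]`, with the
convention `‖·‖_{0,r} = ‖·‖_∞` (supremum norm over `[0,T]`). -/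
def dHolderNorm (r T α : ℝ) (x : ℝ → E) : ℝ≥0∞ :=
  if α = 0 then eSupIcc 0 T x
  else eSupIcc 0 T (fun s => x (min s r)) + eHolderSem r T α x

end

/-- Mesh of the `n`-th partition `r = t_{0,n} < ⋯ < t_{k_n,n} = T`. -/
noncomputable def pmesh (k : ℕ → ℕ) (t : ℕ → ℕ → ℝ) (n : ℕ) : ℝ :=
  sSup ((fun i => t n (i + 1) - t n i) '' Set.Iio (k n))

theorem aux_find (τ : ℕ → ℝ) (s : ℝ) : ∀ k : ℕ, 0 < k → τ 0 ≤ s → s ≤ τ k →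
    ∃ j < k, τ j ≤ s ∧ s ≤ τ (j + 1) := by
  intro k
  induction k with
  | zero => intro h; exact absurd h (lt_irrefl _)
  | succ k ih =>
    intro _ h0 h1
    by_cases hs : τ k ≤ s
    · exact ⟨k, Nat.lt_succ_self k, hs, h1⟩
    · rcases Nat.eq_zero_or_pos k with hk | hk
      · subst hk; exact absurd h0 hs
      · obtain ⟨j, hj, h⟩ := ih hk h0 (le_of_not_ge hs)
        exact ⟨j, Nat.lt_succ_of_lt hj, h⟩

theorem aux_mono (τ : ℕ → ℝ) (k : ℕ) (hm : ∀ i < k, τ i < τ (i + 1)) :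
    ∀ j i : ℕ, i ≤ j → j ≤ k → τ i ≤ τ j := by
  intro j
  induction j with
  | zero => intro i hi _; rw [Nat.le_zero.mp hi]
  | succ j ih =>
    intro i hi hj
    rcases Nat.lt_or_ge i (j + 1) with h | h
    · exact (ih i (by omega) (by omega)).trans (hm j (by omega)).le
    · rw [show i = j + 1 by omega]

theorem aux_pow (h d α β lam : ℝ) (hd : 0 ≤ d) (hdh : d ≤ h) (hα : 0 ≤ α) (hαβ : α < β)
    (hlam : 0 ≤ lam) : lam * d ^ β ≤ lam * h ^ (β - α) * d ^ α := by
  have : d ^ β = d ^ (β - α) * d ^ α := by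
    rw [← Real.rpow_add_of_nonneg hd (by linarith) hα]; congr 1; ring
  rw [this, ← mul_assoc]
  gcongr

theorem aux_lt {E : Type*} [NormedAddCommGroup E] (τ : ℕ → ℝ) (k : ℕ) (hk : 0 < k)
    (hm : ∀ i < k, τ i < τ (i + 1)) (h : ℝ) (hh : 0 < h)
    (hle : ∀ i < k, τ (i + 1) - τ i ≤ h)
    (c : ℝ) (hc : 1 ≤ c) (hbal : ∀ i < k, h ≤ c * (τ (i + 1) - τ i))
    (α β lam δ : ℝ) (hα : 0 ≤ α) (hαβ : α < β) (hlam : 0 ≤ lam) (hδ : 0 ≤ δ) (x : ℝ → E)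
    (hx : ∀ j < k, ∀ s ∈ Set.Icc (τ j) (τ (j + 1)), ∀ u ∈ Set.Icc (τ j) (τ (j + 1)),
      ‖x s - x u‖ ≤ lam * |s - u| ^ β)
    (hn : ∀ j, 1 ≤ j → j ≤ k → ‖x (τ j)‖ ≤ δ * h ^ α)
    (s u : ℝ) (hs : τ 0 ≤ s) (hsu : s < u) (hu : u ≤ τ k) :
    ‖x s - x u‖ ≤ (2 * (lam * h ^ (β - α)) + 2 * (c ^ α * δ)) * |s - u| ^ α := by
  obtain ⟨i, hi, hi1, hi2⟩ := aux_find τ s k hk hs (by linarith)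
  obtain ⟨j, hj, hj1, hj2⟩ := aux_find τ u k hk (by linarith) hu
  have hmo := aux_mono τ k hm
  have hA : 0 ≤ lam * h ^ (β - α) := by positivity
  have hB : 0 ≤ c ^ α * δ := by positivity
  have hD : 0 ≤ |s - u| ^ α := by positivity
  have habs : |s - u| = u - s := by rw [abs_sub_comm, abs_of_pos (by linarith)]
  have key : ∀ j < k, ∀ a b : ℝ, τ j ≤ a → a ≤ b → b ≤ τ (j + 1) → s ≤ a → b ≤ u →
      ‖x a - x b‖ ≤ lam * h ^ (β - α) * |s - u| ^ α := by
    intro j hj a b h1 h2 h3 h4 h5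
    refine (hx j hj a ⟨h1, by linarith⟩ b ⟨by linarith, h3⟩).trans ?_
    have e : |a - b| = b - a := by rw [abs_sub_comm, abs_of_nonneg (by linarith)]
    refine (aux_pow h _ α β lam (abs_nonneg _) ?_ hα hαβ hlam).trans ?_
    · rw [e]; have := hle j hj; linarith
    · exact mul_le_mul_of_nonneg_left
        (Real.rpow_le_rpow (abs_nonneg _) (by rw [e, habs]; linarith) hα) hA
  rcases lt_trichotomy i j with hij | hij | hij
  · have h1 := key i hi s (τ (i + 1)) hi1 hi2 le_rfl le_rfl
      ((hmo j (i + 1) hij hj.le).trans hj1)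
    have h3 := key j hj (τ j) u le_rfl hj1 hj2 (hi2.trans (hmo j (i + 1) hij hj.le)) le_rfl
    have h2 : ‖x (τ (i + 1)) - x (τ j)‖ ≤ 2 * (c ^ α * δ) * |s - u| ^ α := by
      rcases Nat.lt_or_ge (i + 1) j with hl | hl
      · have a1 := hn (i + 1) (by omega) (by omega)
        have a2 := hn j (by omega) (by omega)
        have a3 : h ^ α ≤ c ^ α * |s - u| ^ α := by
          rw [← Real.mul_rpow (by linarith) (abs_nonneg _)]
          refine Real.rpow_le_rpow hh.le ?_ hα
          refine (hbal (i + 1) (by omega)).trans ?_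
          have := hmo j (i + 1 + 1) hl hj.le
          rw [habs]
          gcongr
          linarith
        have a4 := mul_le_mul_of_nonneg_left a3 hδ
        have a5 := norm_sub_le (x (τ (i + 1))) (x (τ j))
        nlinarith
      · rw [show j = i + 1 by omega, sub_self, norm_zero]; positivity
    have h4 : x s - x u = (x s - x (τ (i + 1))) + (x (τ (i + 1)) - x (τ j)) + (x (τ j) - x u) := by
      abel
    have h5 := norm_add₃_le (a := x s - x (τ (i + 1))) (b := x (τ (i + 1)) - x (τ j))
      (c := x (τ j) - x u)
    rw [h4]
    linarith
  · subst hij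
    have := key i hi s u hi1 hsu.le hj2 le_rfl le_rfl
    have h6 : 0 ≤ lam * h ^ (β - α) * |s - u| ^ α := by positivity
    have h7 : 0 ≤ c ^ α * δ * |s - u| ^ α := by positivity
    linarith
  · have := hmo i (j + 1) hij hi.le
    linarith

theorem aux_sup {E : Type*} [NormedAddCommGroup E] (τ : ℕ → ℝ) (k : ℕ) (hk : 0 < k)
    (h : ℝ) (hle : ∀ i < k, τ (i + 1) - τ i ≤ h)
    (β lam δ : ℝ) (hβ : 0 < β) (hlam : 0 ≤ lam) (x : ℝ → E)
    (hx : ∀ j < k, ∀ s ∈ Set.Icc (τ j) (τ (j + 1)), ∀ u ∈ Set.Icc (τ j) (τ (j + 1)),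
      ‖x s - x u‖ ≤ lam * |s - u| ^ β)
    (hn : ∀ j, 1 ≤ j → j ≤ k → ‖x (τ j)‖ ≤ δ)
    (s : ℝ) (hs : τ 0 ≤ s) (hu : s ≤ τ k) :
    ‖x s‖ ≤ lam * h ^ β + δ := by
  obtain ⟨i, hi, hi1, hi2⟩ := aux_find τ s k hk hs hu
  have h1 := hx i hi s ⟨hi1, hi2⟩ (τ (i + 1)) ⟨hi1.trans hi2, le_rfl⟩
  have h2 := hn (i + 1) (by omega) (by omega)
  have h3 : lam * |s - τ (i + 1)| ^ β ≤ lam * h ^ β := by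
    gcongr
    rw [abs_sub_comm, abs_of_nonneg (by linarith)]
    have := hle i hi
    linarith
  have h4 := norm_add_le (x s - x (τ (i + 1))) (x (τ (i + 1)))
  rw [sub_add_cancel] at h4
  linarith

theorem aux_holder_le {E : Type*} [NormedAddCommGroup E] (a b β lam : ℝ) (hlam : 0 < lam)
    (hβ : 0 < β) (x : ℝ → E)
    (h : eHolderSem a b β x < ENNReal.ofReal lam) (s u : ℝ) (hs : s ∈ Set.Icc a b)
    (hu : u ∈ Set.Icc a b) : ‖x s - x u‖ ≤ lam * |s - u| ^ β := by
  by_cases hsu : s = u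
  · subst hsu; simp [Real.zero_rpow hβ.ne']
  · have h1 : ENNReal.ofReal (‖x s - x u‖ / |s - u| ^ β) ≤ eHolderSem a b β x := by
      unfold eHolderSem
      exact le_iSup_of_le (⟨s, hs⟩ : Set.Icc a b) (le_iSup_of_le (⟨u, hu⟩ : Set.Icc a b)
        (le_iSup_of_le hsu le_rfl))
    have h2 := (ENNReal.ofReal_lt_ofReal_iff hlam).mp (h1.trans_lt h)
    have : 0 < |s - u| ^ β := Real.rpow_pos_of_pos (abs_pos.mpr (sub_ne_zero.mpr hsu)) _
    exact ((div_lt_iff₀ this).mp h2).le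

theorem aux_det {E : Type*} [NormedAddCommGroup E] (r T : ℝ) (hr : 0 ≤ r) (hrT : r < T)
    (τ : ℕ → ℝ) (k : ℕ) (hk : 0 < k) (h0 : τ 0 = r) (hT : τ k = T)
    (hm : ∀ i < k, τ i < τ (i + 1)) (h : ℝ) (hh : 0 < h)
    (hle : ∀ i < k, τ (i + 1) - τ i ≤ h)
    (c : ℝ) (hc : 1 ≤ c) (hbal : ∀ i < k, h ≤ c * (τ (i + 1) - τ i))
    (α β lam δ : ℝ) (hα : 0 ≤ α) (hαβ : α < β) (hlam : 0 < lam) (hδ : 0 < δ) (x : ℝ → E)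
    (hI : eSupIcc 0 T (fun s => x (min s r)) < ENNReal.ofReal δ)
    (hA : (⨆ j, ⨆ _ : j < k, eHolderSem (τ j) (τ (j + 1)) β x) < ENNReal.ofReal lam)
    (hN : (⨆ j, ⨆ _ : 1 ≤ j ∧ j ≤ k, (‖x (τ j)‖₊ : ℝ≥0∞)) / ENNReal.ofReal (h ^ α)
      < ENNReal.ofReal δ) :
    dHolderNorm r T α x ≤
      ENNReal.ofReal (δ + (2 * (lam * h ^ (β - α)) + 2 * (c ^ α * δ))) := by
  have hhα : 0 < h ^ α := Real.rpow_pos_of_pos hh _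
  have hx : ∀ j < k, ∀ s ∈ Set.Icc (τ j) (τ (j + 1)), ∀ u ∈ Set.Icc (τ j) (τ (j + 1)),
      ‖x s - x u‖ ≤ lam * |s - u| ^ β := by
    intro j hj s hs u hu
    refine aux_holder_le _ _ β lam hlam (by linarith) x (lt_of_le_of_lt ?_ hA) s u hs hu
    exact le_iSup_of_le j (le_iSup_of_le hj le_rfl)
  have hn : ∀ j, 1 ≤ j → j ≤ k → ‖x (τ j)‖ ≤ δ * h ^ α := by
    intro j h1 h2
    have a1 : (‖x (τ j)‖₊ : ℝ≥0∞) ≤ ⨆ j, ⨆ _ : 1 ≤ j ∧ j ≤ k, (‖x (τ j)‖₊ : ℝ≥0∞) :=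
      le_iSup_of_le j (le_iSup_of_le ⟨h1, h2⟩ le_rfl)
    have a2 : ENNReal.ofReal ‖x (τ j)‖ ≤ ENNReal.ofReal δ * ENNReal.ofReal (h ^ α) := by
      rw [ofReal_norm]
      refine a1.trans ?_
      exact (ENNReal.div_le_iff (by simpa using hhα) ENNReal.ofReal_ne_top).mp hN.le
    rw [← ENNReal.ofReal_mul hδ.le] at a2
    exact (ENNReal.ofReal_le_ofReal_iff (by positivity)).mp a2
  have hA' : 0 ≤ lam * h ^ (β - α) := by positivity
  have hB : δ ≤ c ^ α * δ := le_mul_of_one_le_left hδ.le (Real.one_le_rpow hc hα)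
  unfold dHolderNorm
  split_ifs with h00
  · subst h00
    refine iSup_le ?_
    rintro ⟨s, hs0, hs1⟩
    have hgoal : ‖x s‖ ≤ δ + (2 * (lam * h ^ (β - 0)) + 2 * (c ^ (0:ℝ) * δ)) := by
      by_cases hsr : s ≤ r
      · have a1 : ENNReal.ofReal ‖x s‖ ≤ ENNReal.ofReal δ := by
          rw [ofReal_norm]
          refine le_trans ?_ hI.le
          refine le_iSup_of_le (⟨s, hs0, hs1⟩ : Set.Icc 0 T) ?_
          simp [min_eq_left hsr, enorm_eq_nnnorm]
        have := (ENNReal.ofReal_le_ofReal_iff hδ.le).mp a1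
        rw [Real.rpow_zero] at *
        linarith
      · have := aux_sup τ k hk h hle β lam δ (by linarith) hlam.le x hx
          (by simpa using hn) s (by linarith) (by linarith)
        rw [Real.rpow_zero] at *
        rw [sub_zero] at *
        linarith
    have := ENNReal.ofReal_le_ofReal hgoal
    rwa [ofReal_norm] at this
  · rw [ENNReal.ofReal_add hδ.le (by positivity)]
    refine add_le_add hI.le ?_
    refine iSup_le fun s => iSup_le fun u => iSup_le fun hsu => ?_
    obtain ⟨s, hs⟩ := s
    obtain ⟨u, hu⟩ := u
    simp only at hsu ⊢
    apply ENNReal.ofReal_le_ofReal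
    have : 0 < |s - u| ^ α := Real.rpow_pos_of_pos (abs_pos.mpr (sub_ne_zero.mpr hsu)) _
    rw [div_le_iff₀ this]
    rcases lt_or_gt_of_ne hsu with hl | hl
    · exact aux_lt τ k hk hm h hh hle c hc hbal α β lam δ hα hαβ hlam.le hδ.le x hx hn s u
        (h0 ▸ hs.1) hl (hT ▸ hu.2)
    · rw [norm_sub_rev, abs_sub_comm]
      exact aux_lt τ k hk hm h hh hle c hc hbal α β lam δ hα hαβ hlam.le hδ.le x hx hn u s
        (h0 ▸ hu.1) hl (hT ▸ hs.2)

/-- **Convergence criterion in the delayed Hölder norm along a balanced sequence of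
partitions** (Lemma 3.6 / Statement 8). -/
theorem holder_convergence_along_partitions {m : ℕ} (r T p q α : ℝ)
    (hr : 0 ≤ r) (hrT : r < T) (hp : 0 < p) (hq : 0 < q) (hqp : q ≤ p)
    (hα0 : 0 ≤ α) (hα : α < q / p)
    {Ω : Type*} {mΩ : MeasurableSpace Ω} (P : Measure Ω) [IsProbabilityMeasure P]
    (k : ℕ → ℕ) (t : ℕ → ℕ → ℝ)
    (hk : ∀ n, 0 < k n) (ht0 : ∀ n, t n 0 = r) (htlast : ∀ n, t n (k n) = T)
    (hmono : ∀ n, ∀ i < k n, t n i < t n (i + 1))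
    (hmesh : Filter.Tendsto (pmesh k t) Filter.atTop (nhds 0))
    (cT : ℝ) (hcT : 1 ≤ cT)
    (hbal : ∀ n, ∀ i < k n, pmesh k t n ≤ cT * (t n (i + 1) - t n i))
    (X : ℕ → ℝ → Ω → EuclideanSpace ℝ (Fin m))
    (hrc : ∀ n, ∀ ω : Ω, ∀ u ∈ Set.Ico (0:ℝ) T,
      ContinuousWithinAt (fun s => X n s ω) (Set.Ici u) u)
    (hhold : ∀ β : ℝ, 0 < β → β < q / p → ∃ cβ ≥ (0:ℝ), ∀ n, ∀ lam > (0:ℝ),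
      P {ω | ENNReal.ofReal lam ≤
          ⨆ j, ⨆ _ : j < k n, eHolderSem (t n j) (t n (j + 1)) β (fun s => X n s ω)}
        ≤ ENNReal.ofReal (cβ / lam ^ p))
    (hinit : ∀ ε > (0:ℝ), Filter.Tendsto
      (fun n => P {ω | ENNReal.ofReal ε ≤ eSupIcc 0 T (fun s => X n (min s r) ω)})
      Filter.atTop (nhds 0))
    (hnodes : ∀ ε > (0:ℝ), Filter.Tendsto
      (fun n => P {ω | ENNReal.ofReal ε ≤
        (⨆ j, ⨆ _ : 1 ≤ j ∧ j ≤ k n, (‖X n (t n j) ω‖₊ : ℝ≥0∞)) /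
          ENNReal.ofReal (pmesh k t n ^ α)})
      Filter.atTop (nhds 0)) :
    ∀ ε > (0:ℝ), Filter.Tendsto
      (fun n => P {ω | ENNReal.ofReal ε ≤ dHolderNorm r T α (fun s => X n s ω)})
      Filter.atTop (nhds 0) := by
  intro ε hε
  obtain ⟨β, hαβ, hβ⟩ := exists_between hα
  have hβ0 : 0 < β := hα0.trans_lt hαβ
  obtain ⟨C, hC, hCb⟩ := hhold β hβ0 hβ
  have hle : ∀ n, ∀ i < k n, t n (i + 1) - t n i ≤ pmesh k t n := fun n i hi =>
    le_csSup ((Set.finite_Iio (k n)).image _).bddAbove ⟨i, hi, rfl⟩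
  have hpos : ∀ n, 0 < pmesh k t n := fun n =>
    (sub_pos.mpr (hmono n 0 (hk n))).trans_le (hle n 0 (hk n))
  have hcα : 1 ≤ cT ^ α := Real.one_le_rpow hcT hα0
  set δ : ℝ := ε / (6 * cT ^ α) with hδdef
  have hδ : 0 < δ := by positivity
  have hδε : 6 * (cT ^ α * δ) = ε := by rw [hδdef]; field_simp
  have hδ1 : δ ≤ cT ^ α * δ := le_mul_of_one_le_left hδ.le hcα
  have hlim : Tendsto (fun n => ENNReal.ofReal (C / (δ / pmesh k t n ^ (β - α)) ^ p))
      atTop (nhds 0) := by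
    have e : ∀ n, C / (δ / pmesh k t n ^ (β - α)) ^ p
        = C / δ ^ p * (pmesh k t n ^ (β - α)) ^ p := by
      intro n
      have := hpos n
      rw [Real.div_rpow hδ.le (by positivity)]
      field_simp
    have l1 : Tendsto (fun n => pmesh k t n ^ (β - α)) atTop (nhds 0) := by
      have := hmesh.rpow_const (p := β - α) (Or.inr (by linarith))
      rwa [Real.zero_rpow (by linarith)] at this
    have l2 : Tendsto (fun n => (pmesh k t n ^ (β - α)) ^ p) atTop (nhds 0) := by
      have := l1.rpow_const (p := p) (Or.inr hp.le)
      rwa [Real.zero_rpow hp.ne'] at this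
    have l3 := ENNReal.tendsto_ofReal (l2.const_mul (C / δ ^ p))
    simp only [mul_zero, ENNReal.ofReal_zero] at l3
    simpa only [e] using l3
  have hsum := ((hinit δ hδ).add hlim).add (hnodes δ hδ)
  simp only [add_zero] at hsum
  refine tendsto_of_tendsto_of_tendsto_of_le_of_le tendsto_const_nhds hsum
    (fun n => zero_le) (fun n => ?_)
  have hlam : 0 < δ / pmesh k t n ^ (β - α) := by have := hpos n; positivity
  refine le_trans ?_ (add_le_add_left (add_le_add_right (hCb n _ hlam) _) _)
  refine le_trans (measure_mono ?_) ((measure_union_le _ _).trans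
    (add_le_add_left (measure_union_le _ _) _))
  intro ω hω
  by_contra hcon
  simp only [Set.mem_union, Set.mem_setOf_eq, not_or, not_le] at hcon hω
  obtain ⟨⟨h1, h2⟩, h3⟩ := hcon
  have hd := aux_det r T hr hrT (t n) (k n) (hk n) (ht0 n) (htlast n) (hmono n) (pmesh k t n)
    (hpos n) (hle n) cT hcT (hbal n) α β _ δ hα0 hαβ hlam hδ (fun s => X n s ω) h1 h2 h3
  have hfin := (ENNReal.ofReal_le_ofReal_iff' ).mp (hω.trans hd)
  have hx : δ / pmesh k t n ^ (β - α) * pmesh k t n ^ (β - α) = δ :=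
    div_mul_cancel₀ _ (Real.rpow_pos_of_pos (hpos n) _).ne'
  rw [hx] at hfin
  rcases hfin with h | h <;> linarith
end

section
/- Let (Ω̃,𝔽̃,P̃) be a probability space, (S,ν) a metric space, D ⊆ S, and Y : Ω̃ → S a measurable map such that the pushforward measure P̃∘Y^{−1} is inner regular. If (Y_n)_{n∈ℕ} is a sequence of S-valued measurable maps on Ω̃ that converges to Y in probability (i.e. ν(Y_n,Y) → 0 in probability) and Y_n ∈ D almost surely for all n ∈ ℕ, then supp(P̃∘Y^{−1}) ⊆ closure(D). -/
open MeasureTheory Set Filter ENNReal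

/-- The (topological) support of a Borel measure: the set of points all of whose open
neighborhoods have positive measure. -/
def measSupport {S : Type*} [TopologicalSpace S] [MeasurableSpace S] (μ : MeasureTheory.Measure S) : Set S :=
  {y | ∀ U : Set S, IsOpen U → y ∈ U → 0 < μ U}

/-- **Support lemma, upper bound** (Lemma 4.1(i) / Statement 17): if measurable maps
`Y_n` with values a.s. in `D` converge in probability to `Y` and the law of `Y` is inner
regular, then `supp(P̃∘Y⁻¹) ⊆ closure D`. -/
theorem support_subset_closure_of_tendstoInMeasure {Ω : Type*} {mΩ : MeasurableSpace Ω}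
    (P : Measure Ω) [IsProbabilityMeasure P]
    {S : Type*} [MetricSpace S] [MeasurableSpace S] [BorelSpace S]
    (D : Set S) (Y : Ω → S) (hY : Measurable Y)
    (hreg : (P.map Y).InnerRegular)
    (Yn : ℕ → Ω → S) (hYn : ∀ n, Measurable (Yn n))
    (htendsto : ∀ ε > (0:ℝ), Filter.Tendsto
      (fun n => P {ω | ε ≤ dist (Yn n ω) (Y ω)}) Filter.atTop (nhds 0))
    (hD : ∀ n, ∀ᵐ ω ∂P, Yn n ω ∈ D) :
    measSupport (P.map Y) ⊆ closure D := by
  intro y hy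
  rw [Metric.mem_closure_iff]
  by_contra! hc
  obtain ⟨ε, hε, hfar⟩ := hc
  have hpos := hy (Metric.ball y (ε / 2)) Metric.isOpen_ball (Metric.mem_ball_self (half_pos hε))
  rw [Measure.map_apply hY Metric.isOpen_ball.measurableSet] at hpos
  refine absurd hpos (not_lt.mpr ?_)
  refine ge_of_tendsto' (htendsto (ε / 2) (half_pos hε)) fun n => ?_
  refine measure_mono_ae ?_
  filter_upwards [hD n] with ω hω hωU
  have h1 : dist (Y ω) y < ε / 2 := hωU
  have h2 := hfar _ hω
  have h3 := dist_triangle y (Y ω) (Yn n ω)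
  rw [dist_comm y (Y ω), dist_comm (Y ω) (Yn n ω)] at h3
  change ε / 2 ≤ dist (Yn n ω) (Y ω)
  linarith
end

section
/- Let (Ω̃,𝔽̃,P̃) be a probability space, (S,ν) a metric space, D ⊆ S, and Y : Ω̃ → S a measurable map such that the pushforward measure P̃∘Y^{−1} is inner regular. Suppose that for each y ∈ D there exists a sequence (P̃_{y,n})_{n∈ℕ} of probability measures on (Ω̃,𝔽̃), each absolutely continuous with respect to P̃, such that inf_{n∈ℕ} P̃_{y,n}(ν(Y,y) ≥ ε) < 1 for every ε > 0. Then closure(D) ⊆ supp(P̃∘Y^{−1}). -/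
open MeasureTheory Set Filter ENNReal

/-- **Support lemma, lower bound** (Lemma 4.1(ii) / Statement 18): if for every `y ∈ D`
there are probability measures `P̃_{y,n} ≪ P̃` with
`inf_n P̃_{y,n}(ν(Y,y) ≥ ε) < 1` for all `ε > 0`, and the law of `Y` is inner regular,
then `closure D ⊆ supp(P̃∘Y⁻¹)`. -/
theorem closure_subset_support_of_absolutelyContinuous {Ω : Type*} {mΩ : MeasurableSpace Ω}
    (P : Measure Ω) [IsProbabilityMeasure P]
    {S : Type*} [MetricSpace S] [MeasurableSpace S] [BorelSpace S]
    (D : Set S) (Y : Ω → S) (hY : Measurable Y)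
    (hreg : (P.map Y).InnerRegular)
    (hmeas : ∀ y ∈ D, ∃ Q : ℕ → Measure Ω,
      (∀ n, IsProbabilityMeasure (Q n)) ∧ (∀ n, Q n ≪ P) ∧
      ∀ ε > (0:ℝ), (⨅ n, Q n {ω | ε ≤ dist (Y ω) y}) < 1) :
    closure D ⊆ measSupport (P.map Y) := by
  intro x hx U hU hxU
  obtain ⟨y, hyU, hyD⟩ := mem_closure_iff.1 hx U hU hxU
  obtain ⟨ε, hε, hball⟩ := Metric.isOpen_iff.1 hU y hyU
  obtain ⟨Q, hQ, hac, hinf⟩ := hmeas y hyD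
  rw [pos_iff_ne_zero]
  intro h0
  rw [Measure.map_apply hY hU.measurableSet] at h0
  refine absurd (hinf ε hε) (not_lt.2 (le_iInf fun n => ?_))
  haveI := hQ n
  have h1 : Q n (Y ⁻¹' U) = 0 := hac n h0
  calc (1 : ENNReal) = Q n univ := measure_univ.symm
    _ ≤ Q n (Y ⁻¹' U ∪ {ω | ε ≤ dist (Y ω) y}) := by
        refine measure_mono fun ω _ => ?_
        rcases lt_or_ge (dist (Y ω) y) ε with h | h
        · exact Or.inl (hball h)
        · exact Or.inr h
    _ ≤ Q n (Y ⁻¹' U) + Q n {ω | ε ≤ dist (Y ω) y} := measure_union_le _ _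
    _ = Q n {ω | ε ≤ dist (Y ω) y} := by rw [h1, zero_add]
end
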